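/- arXiv:1701.04912 — 8 statements merged into one kernel-verified Lean document; each statement's English description precedes it below -/
import Mathlib

section
/- Let a < b be real numbers, β ∈ (0,1), and let h : [a,b] → ℝ be continuously differentiable. Then for every x ∈ (a,b] all integrals below converge absolutely and (1/Γ(1−β)) ∫_a^x (x−t)^{−β} h′(t) dt = (β/Γ(1−β)) ∫_0^{x−a} (h(x) − h(x−y)) y^{−1−β} dy + (h(x) − h(a)) / (Γ(1−β) (x−a)^β). -/
open MeasureTheory Real Set Filter Topology

/-- If `|g y| ≤ C y` on `(0,c]` and `g` is continuous there, then `g y * y ^ (-1-β)` is integrable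
for `β < 1`. -/
theorem integrableOn_mul_rpow_of_abs_le {g : ℝ → ℝ} {c C β : ℝ} (hc : 0 ≤ c) (hβ : β < 1)
    (hg : ContinuousOn g (Ioc 0 c)) (hC : ∀ y ∈ Ioc 0 c, |g y| ≤ C * y) :
    IntegrableOn (fun y => g y * y ^ (-1 - β)) (Ioc 0 c) volume := by
  have hint : IntegrableOn (fun y : ℝ => C * y ^ (-β)) (Ioc 0 c) volume :=
    ((intervalIntegrable_iff_integrableOn_Ioc_of_le hc).1
      (intervalIntegral.intervalIntegrable_rpow' (by linarith))).const_mul C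
  refine hint.mono' (ContinuousOn.aestronglyMeasurable (hg.mul ?_) measurableSet_Ioc) ?_
  · exact continuousOn_id.rpow_const fun y hy => Or.inl hy.1.ne'
  · refine (ae_restrict_iff' measurableSet_Ioc).2 (ae_of_all _ fun y hy => ?_)
    have hsplit : y ^ (-β) = y * y ^ (-1 - β) := by
      rw [show -β = 1 + (-1 - β) by ring, rpow_add hy.1, rpow_one]
    rw [norm_mul, Real.norm_eq_abs, Real.norm_of_nonneg (rpow_nonneg hy.1.le _), hsplit, ← mul_assoc]
    exact mul_le_mul_of_nonneg_right (hC y hy) (rpow_nonneg hy.1.le _)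

/-- Integration by parts against the singular weight `y ^ (-β)`, `β < 1`, for a `C¹` function
vanishing at `0`. -/
theorem integral_rpow_neg_mul_deriv {g g' : ℝ → ℝ} {c β : ℝ} (hc : 0 < c) (hβ : β < 1)
    (hg0 : g 0 = 0) (hderiv : ∀ y ∈ Icc 0 c, HasDerivWithinAt g (g' y) (Icc 0 c) y)
    (hcont : ContinuousOn g' (Icc 0 c)) :
    IntervalIntegrable (fun y => y ^ (-β) * g' y) volume 0 c ∧
      IntegrableOn (fun y => g y * y ^ (-1 - β)) (Ioc 0 c) volume ∧
      ∫ y in (0 : ℝ)..c, y ^ (-β) * g' y =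
        β * (∫ y in Ioc 0 c, g y * y ^ (-1 - β)) + g c * c ^ (-β) := by
  have hgc : ContinuousOn g (Icc 0 c) := fun y hy => (hderiv y hy).continuousWithinAt
  obtain ⟨C, hC⟩ := isCompact_Icc.exists_bound_of_continuousOn hcont
  have hbound : ∀ y ∈ Icc 0 c, |g y| ≤ C * y := fun y hy => by
    have := (convex_Icc 0 c).norm_image_sub_le_of_norm_hasDerivWithin_le hderiv hC
      (left_mem_Icc.2 hc.le) hy
    simpa [hg0, abs_of_nonneg hy.1] using this
  have hint₁ : IntervalIntegrable (fun y => y ^ (-β) * g' y) volume 0 c :=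
    (intervalIntegral.intervalIntegrable_rpow' (by linarith)).mul_continuousOn
      (by rwa [uIcc_of_le hc.le])
  have hint₂ := integrableOn_mul_rpow_of_abs_le hc.le hβ (hgc.mono Ioc_subset_Icc_self)
    fun y hy => hbound y (Ioc_subset_Icc_self hy)
  have hint₃ := ((intervalIntegrable_iff_integrableOn_Ioc_of_le hc.le).2 hint₂).const_mul β
  refine ⟨hint₁, hint₂, ?_⟩
  have hzero : Tendsto (fun y => g y * y ^ (-β)) (𝓝[>] 0) (𝓝 0) := by
    have hlim : Tendsto (fun y : ℝ => C * y ^ (1 - β)) (𝓝[>] 0) (𝓝 0) := by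
      have := ((continuousAt_rpow_const 0 (1 - β) (Or.inr (by linarith))).tendsto.const_mul C)
      rw [zero_rpow (by linarith), mul_zero] at this
      exact this.mono_left nhdsWithin_le_nhds
    refine squeeze_zero_norm' ?_ hlim
    filter_upwards [Ioc_mem_nhdsGT hc] with y hy
    rw [norm_mul, Real.norm_eq_abs, Real.norm_of_nonneg (rpow_nonneg hy.1.le _),
      show 1 - β = 1 + -β by ring, rpow_add hy.1, rpow_one, ← mul_assoc]
    exact mul_le_mul_of_nonneg_right (hbound y (Ioc_subset_Icc_self hy)) (rpow_nonneg hy.1.le _)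
  have hend : Tendsto (fun y => g y * y ^ (-β)) (𝓝[<] c) (𝓝 (g c * c ^ (-β))) := by
    have hleft : Tendsto g (𝓝[<] c) (𝓝 (g c)) := by
      rw [← nhdsWithin_Ioo_eq_nhdsLT hc]
      exact (hgc c (right_mem_Icc.2 hc.le)).mono Ioo_subset_Icc_self
    exact hleft.mul
      ((continuousAt_rpow_const c (-β) (Or.inl hc.ne')).tendsto.mono_left nhdsWithin_le_nhds)
  have hftc := intervalIntegral.integral_eq_sub_of_hasDerivAt_of_tendsto hc
    (f' := fun y => y ^ (-β) * g' y - β * (g y * y ^ (-1 - β))) (fun y hy => ?_)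
    (hint₁.sub hint₃) hzero hend
  · rw [intervalIntegral.integral_sub hint₁ hint₃, intervalIntegral.integral_const_mul,
      intervalIntegral.integral_of_le hc.le (f := fun y => g y * y ^ (-1 - β))] at hftc
    linarith
  · have := ((hderiv y (Ioo_subset_Icc_self hy)).hasDerivAt (Icc_mem_nhds hy.1 hy.2)).mul
      (hasDerivAt_rpow_const (p := -β) (Or.inl hy.1.ne'))
    refine this.congr_deriv ?_
    rw [show -β - 1 = -1 - β by ring]
    ring

/-- For `a < b`, `β ∈ (0,1)` and `h` continuously differentiable on `[a,b]`
(with derivative `h'`), for every `x ∈ (a,b]` the integrals defining the classical left-sided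
Caputo derivative and its generator form converge absolutely, and
`(1/Γ(1−β)) ∫_a^x (x−t)^{−β} h′(t) dt
  = (β/Γ(1−β)) ∫_0^{x−a} (h(x) − h(x−y)) y^{−1−β} dy + (h(x) − h(a))/(Γ(1−β)(x−a)^β)`. -/
theorem caputo_left_generator_form
    (a b β : ℝ) (hab : a < b) (hβ : β ∈ Set.Ioo (0 : ℝ) 1)
    (h h' : ℝ → ℝ)
    (hderiv : ∀ t ∈ Set.Icc a b, HasDerivWithinAt h (h' t) (Set.Icc a b) t)
    (hcont : ContinuousOn h' (Set.Icc a b)) :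
    ∀ x ∈ Set.Ioc a b,
      IntegrableOn (fun t => (x - t) ^ (-β) * h' t) (Set.Ioc a x) volume ∧
      IntegrableOn (fun y => (h x - h (x - y)) * y ^ (-1 - β)) (Set.Ioc 0 (x - a)) volume ∧
      (1 / Real.Gamma (1 - β)) * (∫ t in Set.Ioc a x, (x - t) ^ (-β) * h' t) =
        (β / Real.Gamma (1 - β)) * (∫ y in Set.Ioc 0 (x - a), (h x - h (x - y)) * y ^ (-1 - β))
          + (h x - h a) / (Real.Gamma (1 - β) * (x - a) ^ β) := by
  intro x hx
  have hc : 0 < x - a := sub_pos.2 hx.1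
  have hmaps : MapsTo (fun y => x - y) (Icc 0 (x - a)) (Icc a b) := fun y hy =>
    ⟨by linarith [hy.2], by linarith [hy.1, hx.2]⟩
  obtain ⟨hint₁, hint₂, heq⟩ := integral_rpow_neg_mul_deriv (g := fun y => h x - h (x - y))
    (g' := fun y => h' (x - y)) hc hβ.2 (by simp)
    (fun y hy => by
      have hsub : HasDerivWithinAt (fun y : ℝ => x - y) (-1) (Icc 0 (x - a)) y :=
        (hasDerivWithinAt_id y _).const_sub x
      have := ((hderiv (x - y) (hmaps hy)).comp y hsub hmaps).const_sub (h x)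
      simpa using this)
    (hcont.comp (by fun_prop) hmaps)
  refine ⟨?_, hint₂, ?_⟩
  · rw [← intervalIntegrable_iff_integrableOn_Ioc_of_le hx.1.le]
    simpa using (hint₁.comp_sub_left x).symm
  · have hsubst := intervalIntegral.integral_comp_sub_left
      (fun y => y ^ (-β) * h' (x - y)) x (a := a) (b := x)
    simp only [sub_sub_cancel, sub_self] at hsubst
    rw [← intervalIntegral.integral_of_le hx.1.le, hsubst, heq, sub_sub_cancel, rpow_neg hc.le]
    have hΓ : Real.Gamma (1 - β) ≠ 0 := (Real.Gamma_pos_of_pos (by linarith [hβ.2])).ne'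
    have hpow : (x - a) ^ β ≠ 0 := (rpow_pos_of_pos hc β).ne'
    field_simp
end

section
/- Let ν satisfy condition (H0), let a < b be real numbers, and let h : [a,b] → ℝ be continuously differentiable. Then for every x ∈ [a,b] both integrals defining (−D^{(ν)}_{a+*} h)(x) converge absolutely, and |(−D^{(ν)}_{a+*} h)(x)| ≤ (‖h′‖_∞ + 2‖h‖_∞) · sup_z ∫_{ℝ∖{0}} min(1,|y|) ν(z,y) dy, where ‖·‖_∞ denotes the sup-norm on [a,b]. -/
open MeasureTheory Real Set Filter Topology

/-- Condition (H0) of Hernández-Hernández & Kolokoltsov: `ν : ℝ × (ℝ∖{0}) → [0,∞)` is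
continuous, continuously differentiable in the first variable, has first moment
`∫ min(1,|y|) ν(x,y) dy` bounded uniformly in `x` (also for `∂_x ν`), and the small-jump
moments `∫_{0<|y|≤δ} |y| ν(x,y) dy` tend to `0` uniformly in `x` as `δ → 0`. -/
structure CondH0 (ν : ℝ → ℝ → ℝ) : Prop where
  nonneg : ∀ x y : ℝ, y ≠ 0 → 0 ≤ ν x y
  contOn : ContinuousOn (fun p : ℝ × ℝ => ν p.1 p.2) {p : ℝ × ℝ | p.2 ≠ 0}
  diff_x : ∀ y : ℝ, y ≠ 0 → Differentiable ℝ (fun x => ν x y)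
  cont_deriv_x : ContinuousOn (fun p : ℝ × ℝ => deriv (fun x => ν x p.2) p.1)
    {p : ℝ × ℝ | p.2 ≠ 0}
  moment_bdd : ∃ M : ℝ, ∀ x : ℝ,
    IntegrableOn (fun y => min 1 |y| * ν x y) {(0 : ℝ)}ᶜ volume ∧
    (∫ y in {(0 : ℝ)}ᶜ, min 1 |y| * ν x y) ≤ M
  moment_deriv_bdd : ∃ M : ℝ, ∀ x : ℝ,
    IntegrableOn (fun y => min 1 |y| * |deriv (fun z => ν z y) x|) {(0 : ℝ)}ᶜ volume ∧
    (∫ y in {(0 : ℝ)}ᶜ, min 1 |y| * |deriv (fun z => ν z y) x|) ≤ M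
  small_jumps : ∀ ε > (0 : ℝ), ∃ δ > (0 : ℝ), ∀ x : ℝ,
    (∫ y in {y : ℝ | y ≠ 0 ∧ |y| ≤ δ}, |y| * ν x y) < ε

/-- The generalized left-sided Caputo type operator with terminal `a`:
`(−D^{(ν)}_{a+*} h)(x) = ∫_0^{x−a} (h(x−y) − h(x)) ν(x,y) dy
                          + ∫_{x−a}^∞ (h(a) − h(x)) ν(x,y) dy`. -/
noncomputable def DCaputoLeft (ν : ℝ → ℝ → ℝ) (a : ℝ) (h : ℝ → ℝ) (x : ℝ) : ℝ :=
  (∫ y in Set.Ioc 0 (x - a), (h (x - y) - h x) * ν x y)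
    + ∫ y in Set.Ioi (x - a), (h a - h x) * ν x y

/-- The generalized right-sided Caputo type operator with terminal `b`:
`(−D^{(ν)}_{b−*} h)(x) = ∫_0^{b−x} (h(x+y) − h(x)) ν(x,y) dy
                          + ∫_{b−x}^∞ (h(b) − h(x)) ν(x,y) dy`. -/
noncomputable def DCaputoRight (ν : ℝ → ℝ → ℝ) (b : ℝ) (h : ℝ → ℝ) (x : ℝ) : ℝ :=
  (∫ y in Set.Ioc 0 (b - x), (h (x + y) - h x) * ν x y)
    + ∫ y in Set.Ioi (b - x), (h b - h x) * ν x y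

/-- A `C¹` function on `[a,b]` has increments at most `(‖h'‖_∞ + 2‖h‖_∞) min(1, |s - t|)`. -/
theorem abs_sub_le_iSup_deriv_add_two_mul_iSup_mul_min {a b : ℝ} {h h' : ℝ → ℝ}
    (hderiv : ∀ t ∈ Set.Icc a b, HasDerivWithinAt h (h' t) (Set.Icc a b) t)
    (hcont : ContinuousOn h' (Set.Icc a b)) {s t : ℝ}
    (hs : s ∈ Set.Icc a b) (ht : t ∈ Set.Icc a b) :
    |h s - h t| ≤ ((⨆ z : Set.Icc a b, |h' (z : ℝ)|) + 2 * ⨆ z : Set.Icc a b, |h (z : ℝ)|) *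
      min 1 |s - t| := by
  have le_iSup_abs {f : ℝ → ℝ} (hf : ContinuousOn f (Set.Icc a b)) :
      ∀ u ∈ Set.Icc a b, |f u| ≤ ⨆ z : Set.Icc a b, |f (z : ℝ)| := by
    intro u hu
    have hbdd : BddAbove (Set.range fun z : Set.Icc a b => |f (z : ℝ)|) :=
      isCompact_range (continuousOn_iff_continuous_domRestrict.mp hf.abs) |>.bddAbove
    exact le_ciSup hbdd ⟨u, hu⟩
  have hh' := le_iSup_abs hcont
  have hh := le_iSup_abs fun t ht => (hderiv t ht).continuousWithinAt
  have hA := (abs_nonneg _).trans (hh' s hs)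
  have hB := (abs_nonneg _).trans (hh s hs)
  set A := ⨆ z : Set.Icc a b, |h' (z : ℝ)|
  set B := ⨆ z : Set.Icc a b, |h (z : ℝ)|
  have lipschitz : |h s - h t| ≤ A * |s - t| :=
    (convex_Icc a b).norm_image_sub_le_of_norm_hasDerivWithin_le hderiv hh' ht hs
  have bounded : |h s - h t| ≤ 2 * B := by
    linarith [abs_sub (h s) (h t), hh s hs, hh t ht]
  rcases min_choice 1 |s - t| with hm | hm <;> rw [hm]
  · linarith
  · nlinarith [abs_nonneg (s - t)]

/-- Under condition (H0), for `h` continuously differentiable on `[a,b]`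
(with derivative `h'`) and any `x ∈ [a,b]`, both integrals defining `(−D^{(ν)}_{a+*} h)(x)`
converge absolutely and
`|(−D^{(ν)}_{a+*} h)(x)| ≤ (‖h′‖_∞ + 2‖h‖_∞) · sup_z ∫_{ℝ∖{0}} min(1,|y|) ν(z,y) dy`. -/
theorem generalized_caputo_left_bound
    (ν : ℝ → ℝ → ℝ) (hν : CondH0 ν)
    (a b : ℝ) (hab : a < b)
    (h h' : ℝ → ℝ)
    (hderiv : ∀ t ∈ Set.Icc a b, HasDerivWithinAt h (h' t) (Set.Icc a b) t)
    (hcont : ContinuousOn h' (Set.Icc a b)) :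
    ∀ x ∈ Set.Icc a b,
      IntegrableOn (fun y => (h (x - y) - h x) * ν x y) (Set.Ioc 0 (x - a)) volume ∧
      IntegrableOn (fun y => (h a - h x) * ν x y) (Set.Ioi (x - a)) volume ∧
      |DCaputoLeft ν a h x| ≤
        ((⨆ z : Set.Icc a b, |h' (z : ℝ)|) + 2 * ⨆ z : Set.Icc a b, |h (z : ℝ)|) *
          ⨆ z : ℝ, ∫ y in {(0 : ℝ)}ᶜ, min 1 |y| * ν z y := by
  intro x hx
  have hax : 0 ≤ x - a := sub_nonneg.mpr hx.1
  have ha : a ∈ Set.Icc a b := ⟨le_rfl, hab.le⟩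
  have key := fun s t hs ht =>
    abs_sub_le_iSup_deriv_add_two_mul_iSup_mul_min hderiv hcont (s := s) (t := t) hs ht
  have hC : 0 ≤ (⨆ z : Set.Icc a b, |h' (z : ℝ)|) + 2 * ⨆ z : Set.Icc a b, |h (z : ℝ)| :=
    add_nonneg (Real.iSup_nonneg fun _ => abs_nonneg _)
      (mul_nonneg zero_le_two (Real.iSup_nonneg fun _ => abs_nonneg _))
  set C := (⨆ z : Set.Icc a b, |h' (z : ℝ)|) + 2 * ⨆ z : Set.Icc a b, |h (z : ℝ)|
  have hh : ContinuousOn h (Set.Icc a b) := fun t ht => (hderiv t ht).continuousWithinAt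
  obtain ⟨M, hM⟩ := hν.moment_bdd
  have hsub : Set.Ioi (0 : ℝ) ⊆ {(0 : ℝ)}ᶜ := fun y hy => (Set.mem_Ioi.mp hy).ne'
  -- Freezing `h` at the value `h a` to the left of `a` merges both integrals into one.
  let F : ℝ → ℝ := fun y => (h (max a (x - y)) - h x) * ν x y
  have hmaps : ∀ y ∈ Set.Ioi (0 : ℝ), max a (x - y) ∈ Set.Icc a b := fun y hy =>
    ⟨le_max_left _ _, max_le hab.le (by linarith [hx.2, Set.mem_Ioi.mp hy])⟩
  have hFcont : ContinuousOn F (Set.Ioi 0) :=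
    ((hh.comp (by fun_prop) hmaps).sub continuousOn_const).mul
      (hν.contOn.comp (f := fun y => (x, y)) (by fun_prop) hsub)
  have hFbound : ∀ y ∈ Set.Ioi (0 : ℝ), ‖F y‖ ≤ C * (min 1 |y| * ν x y) := by
    intro y hy
    have hy0 : 0 < y := hy
    have hdist : |max a (x - y) - x| ≤ |y| := by
      rw [abs_of_pos hy0, abs_le]
      constructor
      · linarith [le_max_right a (x - y)]
      · linarith [max_le hx.1 (by linarith : x - y ≤ x)]
    have hνy := hν.nonneg x y hy0.ne'
    rw [Real.norm_eq_abs, abs_mul, abs_of_nonneg hνy, ← mul_assoc]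
    gcongr
    exact (key _ _ (hmaps y hy) hx).trans (by gcongr)
  have hdom : IntegrableOn (fun y => C * (min 1 |y| * ν x y)) (Set.Ioi 0) :=
    ((hM x).1.mono_set hsub).const_mul C
  have hFint : IntegrableOn F (Set.Ioi 0) :=
    hdom.mono' (hFcont.aestronglyMeasurable measurableSet_Ioi)
      (ae_restrict_of_forall_mem measurableSet_Ioi hFbound)
  have hFIoc : Set.EqOn F (fun y => (h (x - y) - h x) * ν x y) (Set.Ioc 0 (x - a)) := by
    intro y hy
    simp only [F, max_eq_right (by linarith [hy.2] : a ≤ x - y)]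
  have hFIoi : Set.EqOn F (fun y => (h a - h x) * ν x y) (Set.Ioi (x - a)) := by
    intro y hy
    simp only [F, max_eq_left (by linarith [Set.mem_Ioi.mp hy] : x - y ≤ a)]
  have hint₁ := hFint.mono_set (Set.Ioc_subset_Ioi_self : Set.Ioc 0 (x - a) ⊆ _)
  have hint₂ := hFint.mono_set (Set.Ioi_subset_Ioi hax)
  refine ⟨hint₁.congr_fun hFIoc measurableSet_Ioc, hint₂.congr_fun hFIoi measurableSet_Ioi, ?_⟩
  have hD : DCaputoLeft ν a h x = ∫ y in Set.Ioi 0, F y := by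
    rw [DCaputoLeft, ← setIntegral_congr_fun measurableSet_Ioc hFIoc,
      ← setIntegral_congr_fun measurableSet_Ioi hFIoi,
      ← setIntegral_union (Set.Ioc_disjoint_Ioi le_rfl) measurableSet_Ioi hint₁ hint₂,
      Set.Ioc_union_Ioi_eq_Ioi hax]
  have hbdd : BddAbove (Set.range fun z => ∫ y in {(0 : ℝ)}ᶜ, min 1 |y| * ν z y) :=
    ⟨M, Set.forall_mem_range.mpr fun z => (hM z).2⟩
  calc |DCaputoLeft ν a h x| = ‖∫ y in Set.Ioi 0, F y‖ := by rw [hD, Real.norm_eq_abs]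
    _ ≤ ∫ y in Set.Ioi 0, C * (min 1 |y| * ν x y) :=
        norm_integral_le_of_norm_le hdom (ae_restrict_of_forall_mem measurableSet_Ioi hFbound)
    _ = C * ∫ y in Set.Ioi 0, min 1 |y| * ν x y := integral_const_mul _ _
    _ ≤ C * ∫ y in {(0 : ℝ)}ᶜ, min 1 |y| * ν x y := by
        refine mul_le_mul_of_nonneg_left (setIntegral_mono_set (hM x).1 ?_ hsub.eventuallyLE) hC
        exact ae_restrict_of_forall_mem (measurableSet_singleton 0).compl fun y hy =>
          mul_nonneg (le_min zero_le_one (abs_nonneg y)) (hν.nonneg x y hy)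
    _ ≤ C * ⨆ z : ℝ, ∫ y in {(0 : ℝ)}ᶜ, min 1 |y| * ν z y :=
        mul_le_mul_of_nonneg_left (le_ciSup hbdd x) hC
end

section
/- Let ν satisfy condition (H0), let a < b be real numbers, and let h : [a,b] → ℝ be continuously differentiable. Then for every x ∈ [a,b] both integrals defining (−D^{(ν)}_{b−*} h)(x) converge absolutely, and |(−D^{(ν)}_{b−*} h)(x)| ≤ (‖h′‖_∞ + 2‖h‖_∞) · sup_z ∫_{ℝ∖{0}} min(1,|y|) ν(z,y) dy, where ‖·‖_∞ denotes the sup-norm on [a,b]. -/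
open MeasureTheory Real Set Filter Topology

/-- An increment of a function with derivative bounded by `K` and values bounded by `L`,
over a step of length at most `y`, is at most `(K + 2 * L) * min 1 y`. -/
theorem abs_sub_le_mul_min_one {f f' : ℝ → ℝ} {a b K L : ℝ}
    (hf : ∀ t ∈ Set.Icc a b, HasDerivWithinAt f (f' t) (Set.Icc a b) t)
    (hK : ∀ t ∈ Set.Icc a b, |f' t| ≤ K) (hL : ∀ t ∈ Set.Icc a b, |f t| ≤ L)
    {s t y : ℝ} (hs : s ∈ Set.Icc a b) (ht : t ∈ Set.Icc a b) (hst : |t - s| ≤ y) :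
    |f t - f s| ≤ (K + 2 * L) * min 1 y := by
  have hK0 : 0 ≤ K := (abs_nonneg _).trans (hK s hs)
  have hL0 : 0 ≤ L := (abs_nonneg _).trans (hL s hs)
  have hy : 0 ≤ y := (abs_nonneg _).trans hst
  have hlip : |f t - f s| ≤ K * |t - s| := by
    simpa only [Real.norm_eq_abs] using
      (convex_Icc a b).norm_image_sub_le_of_norm_hasDerivWithin_le hf
        (fun u hu => by simpa only [Real.norm_eq_abs] using hK u hu) hs ht
  have htriangle : |f t - f s| ≤ 2 * L := by
    linarith [abs_sub (f t) (f s), hL t ht, hL s hs]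
  rcases le_total 1 y with h1 | h1
  · rw [min_eq_left h1]
    linarith
  · rw [min_eq_right h1]
    nlinarith [mul_le_mul_of_nonneg_left hst hK0, mul_nonneg hL0 hy]

/-- The two integrals of `DCaputoRight` are those of a single function, in which the jump is
stopped at the terminal `b`. -/
theorem DCaputoRight_eq_integral_min {ν : ℝ → ℝ → ℝ} {b x : ℝ} {h : ℝ → ℝ} (hx : x ≤ b)
    (hint : IntegrableOn (fun y => (h (min (x + y) b) - h x) * ν x y) (Set.Ioi 0) volume) :
    IntegrableOn (fun y => (h (x + y) - h x) * ν x y) (Set.Ioc 0 (b - x)) volume ∧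
    IntegrableOn (fun y => (h b - h x) * ν x y) (Set.Ioi (b - x)) volume ∧
    DCaputoRight ν b h x = ∫ y in Set.Ioi 0, (h (min (x + y) b) - h x) * ν x y := by
  have hbx : 0 ≤ b - x := sub_nonneg.2 hx
  have h1 : Set.EqOn (fun y => (h (min (x + y) b) - h x) * ν x y)
      (fun y => (h (x + y) - h x) * ν x y) (Set.Ioc 0 (b - x)) := fun y hy => by
    simp only [min_eq_left (show x + y ≤ b by linarith [hy.2])]
  have h2 : Set.EqOn (fun y => (h (min (x + y) b) - h x) * ν x y)
      (fun y => (h b - h x) * ν x y) (Set.Ioi (b - x)) := fun y hy => by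
    simp only [min_eq_right (show b ≤ x + y by linarith [Set.mem_Ioi.1 hy])]
  have i1 := hint.mono_set (Set.Ioc_subset_Ioi_self : Set.Ioc 0 (b - x) ⊆ _)
  have i2 := hint.mono_set (Set.Ioi_subset_Ioi hbx)
  refine ⟨i1.congr_fun h1 measurableSet_Ioc, i2.congr_fun h2 measurableSet_Ioi, ?_⟩
  rw [← Set.Ioc_union_Ioi_eq_Ioi hbx,
    setIntegral_union (Set.Ioc_disjoint_Ioi le_rfl) measurableSet_Ioi i1 i2,
    setIntegral_congr_fun measurableSet_Ioc h1, setIntegral_congr_fun measurableSet_Ioi h2,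
    DCaputoRight]

/-- Under condition (H0), for `h` continuously differentiable on `[a,b]`
(with derivative `h'`) and any `x ∈ [a,b]`, both integrals defining `(−D^{(ν)}_{b−*} h)(x)`
converge absolutely and
`|(−D^{(ν)}_{b−*} h)(x)| ≤ (‖h′‖_∞ + 2‖h‖_∞) · sup_z ∫_{ℝ∖{0}} min(1,|y|) ν(z,y) dy`. -/
theorem generalized_caputo_right_bound
    (ν : ℝ → ℝ → ℝ) (hν : CondH0 ν)
    (a b : ℝ) (hab : a < b)
    (h h' : ℝ → ℝ)
    (hderiv : ∀ t ∈ Set.Icc a b, HasDerivWithinAt h (h' t) (Set.Icc a b) t)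
    (hcont : ContinuousOn h' (Set.Icc a b)) :
    ∀ x ∈ Set.Icc a b,
      IntegrableOn (fun y => (h (x + y) - h x) * ν x y) (Set.Ioc 0 (b - x)) volume ∧
      IntegrableOn (fun y => (h b - h x) * ν x y) (Set.Ioi (b - x)) volume ∧
      |DCaputoRight ν b h x| ≤
        ((⨆ z : Set.Icc a b, |h' (z : ℝ)|) + 2 * ⨆ z : Set.Icc a b, |h (z : ℝ)|) *
          ⨆ z : ℝ, ∫ y in {(0 : ℝ)}ᶜ, min 1 |y| * ν z y := by
  intro x hx
  have hh : ContinuousOn h (Set.Icc a b) := fun t ht => (hderiv t ht).continuousWithinAt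
  have le_sup : ∀ f : ℝ → ℝ, ContinuousOn f (Set.Icc a b) → ∀ t ∈ Set.Icc a b,
      |f t| ≤ ⨆ z : Set.Icc a b, |f (z : ℝ)| := fun f hf t ht => by
    have hbdd : BddAbove (Set.range fun z : Set.Icc a b => |f (z : ℝ)|) := by
      simpa only [Set.image_eq_range] using isCompact_Icc.bddAbove_image hf.abs
    exact le_ciSup hbdd ⟨t, ht⟩
  have hK := le_sup h' hcont
  have hL := le_sup h hh
  set K := ⨆ z : Set.Icc a b, |h' (z : ℝ)|
  set L := ⨆ z : Set.Icc a b, |h (z : ℝ)|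
  have hC : 0 ≤ K + 2 * L := by
    linarith [(abs_nonneg _).trans (hK x hx), (abs_nonneg _).trans (hL x hx)]
  have hmem : ∀ y ∈ Set.Ioi (0 : ℝ), min (x + y) b ∈ Set.Icc a b := fun y hy =>
    ⟨le_min (by linarith [hx.1, Set.mem_Ioi.1 hy]) hab.le, min_le_right _ _⟩
  have hbound : ∀ y ∈ Set.Ioi (0 : ℝ), ‖(h (min (x + y) b) - h x) * ν x y‖ ≤
      (K + 2 * L) * (min 1 |y| * ν x y) := fun y hy => by
    have hy0 : 0 < y := hy
    have hdist : |min (x + y) b - x| ≤ |y| := by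
      rw [abs_of_nonneg (sub_nonneg.2 (le_min (by linarith) hx.2)), abs_of_pos hy0]
      linarith [min_le_left (x + y) b]
    have hν0 : 0 ≤ ν x y := hν.nonneg x y hy0.ne'
    rw [norm_mul, Real.norm_eq_abs, Real.norm_eq_abs, abs_of_nonneg hν0, ← mul_assoc]
    exact mul_le_mul_of_nonneg_right
      (abs_sub_le_mul_min_one hderiv hK hL hx (hmem y hy) hdist) hν0
  have hsub : Set.Ioi (0 : ℝ) ⊆ {(0 : ℝ)}ᶜ := fun y hy => (Set.mem_Ioi.1 hy).ne'
  obtain ⟨M, hM⟩ := hν.moment_bdd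
  have hdom := ((hM x).1.mono_set hsub).const_mul (K + 2 * L)
  have hcts : ContinuousOn (fun y => (h (min (x + y) b) - h x) * ν x y) (Set.Ioi 0) :=
    ((hh.comp (by fun_prop : Continuous fun y : ℝ => min (x + y) b).continuousOn hmem).sub
      continuousOn_const).mul
      (hν.contOn.comp (by fun_prop : Continuous fun y : ℝ => (x, y)).continuousOn hsub)
  have hae := (ae_restrict_iff' (μ := volume) measurableSet_Ioi).2
    (Filter.Eventually.of_forall hbound)
  have hint : IntegrableOn (fun y => (h (min (x + y) b) - h x) * ν x y) (Set.Ioi 0) volume :=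
    hdom.mono' (hcts.aestronglyMeasurable measurableSet_Ioi) hae
  obtain ⟨hi1, hi2, heq⟩ := DCaputoRight_eq_integral_min hx.2 hint
  refine ⟨hi1, hi2, ?_⟩
  rw [heq]
  calc |∫ y in Set.Ioi 0, (h (min (x + y) b) - h x) * ν x y|
      ≤ ∫ y in Set.Ioi 0, (K + 2 * L) * (min 1 |y| * ν x y) :=
        norm_integral_le_of_norm_le hdom hae
    _ = (K + 2 * L) * ∫ y in Set.Ioi 0, min 1 |y| * ν x y := integral_const_mul _ _
    _ ≤ (K + 2 * L) * ∫ y in {(0 : ℝ)}ᶜ, min 1 |y| * ν x y := by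
        refine mul_le_mul_of_nonneg_left (setIntegral_mono_set (hM x).1 ?_ hsub.eventuallyLE) hC
        refine (ae_restrict_iff' (measurableSet_singleton 0).compl).2
          (Filter.Eventually.of_forall fun y hy => ?_)
        exact mul_nonneg (le_min zero_le_one (abs_nonneg y)) (hν.nonneg x y hy)
    _ ≤ (K + 2 * L) * ⨆ z : ℝ, ∫ y in {(0 : ℝ)}ᶜ, min 1 |y| * ν z y :=
        mul_le_mul_of_nonneg_left
          (le_ciSup (f := fun z : ℝ => ∫ y in {(0 : ℝ)}ᶜ, min 1 |y| * ν z y)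
            ⟨M, Set.forall_mem_range.2 fun z => (hM z).2⟩ x) hC
end

section
/- Let ν₊ and ν₋ satisfy condition (H0), let a < b, and set ν(x,y) = ν₊(x,y) for y > 0 and ν(x,y) = ν₋(x,−y) for y < 0. Then for every continuously differentiable f : [a,b] → ℝ and every x ∈ [a,b], |(−D^{(ν₊)}_{a+*} f)(x) + (−D^{(ν₋)}_{b−*} f)(x)| ≤ ‖f′‖_∞ · ∫_{ℝ∖{0}} min(|y|, b−a) ν(x,y) dy, where ‖f′‖_∞ = sup_{z∈[a,b]} |f′(z)|. -/
open MeasureTheory Real Set Filter Topology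

/-- Under (H0), a truncated first moment over positive jumps is finite at any level `D`. -/
theorem CondH0.integrableOn_min_mul {ν : ℝ → ℝ → ℝ} (hν : CondH0 ν) (x : ℝ) {D : ℝ}
    (hD : 0 < D) : IntegrableOn (fun y => min |y| D * ν x y) (Ioi 0) := by
  obtain ⟨M, hM⟩ := hν.moment_bdd
  have hint : IntegrableOn (fun y => min 1 |y| * ν x y) (Ioi 0) :=
    (hM x).1.mono_set fun y (hy : 0 < y) => hy.ne'
  have hw : ContinuousOn (fun y => ν x y) (Ioi 0) :=
    hν.contOn.comp (f := fun y : ℝ => (x, y)) (by fun_prop)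
      fun y (hy : 0 < y) => hy.ne'
  refine Integrable.mono' (hint.const_mul (max 1 D)) ?_ ?_
  · refine ContinuousOn.aestronglyMeasurable ?_ measurableSet_Ioi
    fun_prop
  · refine (ae_restrict_iff' measurableSet_Ioi).2 (ae_of_all _ fun y (hy : 0 < y) => ?_)
    have hν0 := hν.nonneg x y hy.ne'
    rw [norm_mul, Real.norm_of_nonneg hν0, abs_of_pos hy,
      Real.norm_of_nonneg (le_min hy.le hD.le), ← mul_assoc]
    refine mul_le_mul_of_nonneg_right ?_ hν0
    rcases le_total 1 y with h | h
    · rw [min_eq_left h, mul_one]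
      exact (min_le_right _ _).trans (le_max_right _ _)
    · rw [min_eq_right h]
      exact (min_le_left _ _).trans (le_mul_of_one_le_left hy.le (le_max_left _ _))

/-- One-sided estimate: an increment of size at most `L * y`, frozen after the jump size `c`,
integrates to at most `L` times the first moment truncated at any level `D ≥ c`. -/
theorem abs_integral_Ioc_add_integral_Ioi_le {w φ : ℝ → ℝ} {L c D k : ℝ}
    (hw : ∀ y, 0 < y → 0 ≤ w y) (hint : IntegrableOn (fun y => min |y| D * w y) (Ioi 0))
    (hL : 0 ≤ L) (hc : 0 ≤ c) (hcD : c ≤ D)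
    (hφ : ∀ y ∈ Ioc 0 c, |φ y| ≤ L * y) (hk : |k| ≤ L * c) :
    |(∫ y in Ioc 0 c, φ y * w y) + ∫ y in Ioi c, k * w y| ≤
      L * ∫ y in Ioi 0, min |y| D * w y := by
  have hint₁ := (hint.mono_set Ioc_subset_Ioi_self : IntegrableOn _ (Ioc 0 c)).const_mul L
  have hint₂ := (hint.mono_set (Ioi_subset_Ioi hc)).const_mul L
  have h₁ : |∫ y in Ioc 0 c, φ y * w y| ≤ ∫ y in Ioc 0 c, L * (min |y| D * w y) := by
    rw [← Real.norm_eq_abs]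
    refine norm_integral_le_of_norm_le hint₁
      ((ae_restrict_iff' measurableSet_Ioc).2 (ae_of_all _ fun y hy => ?_))
    rw [norm_mul, Real.norm_of_nonneg (hw y hy.1), abs_of_pos hy.1,
      min_eq_left (hy.2.trans hcD), ← mul_assoc]
    exact mul_le_mul_of_nonneg_right (hφ y hy) (hw y hy.1)
  have h₂ : |∫ y in Ioi c, k * w y| ≤ ∫ y in Ioi c, L * (min |y| D * w y) := by
    rw [← Real.norm_eq_abs]
    refine norm_integral_le_of_norm_le hint₂
      ((ae_restrict_iff' measurableSet_Ioi).2 (ae_of_all _ fun y (hy : c < y) => ?_))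
    have hy0 := hc.trans_lt hy
    rw [norm_mul, Real.norm_of_nonneg (hw y hy0), abs_of_pos hy0, ← mul_assoc]
    exact mul_le_mul_of_nonneg_right
      (hk.trans (mul_le_mul_of_nonneg_left (le_min hy.le hcD) hL)) (hw y hy0)
  rw [← integral_const_mul, ← Ioc_union_Ioi_eq_Ioi hc,
    setIntegral_union (Ioc_disjoint_Ioi le_rfl) measurableSet_Ioi hint₁ hint₂]
  exact (abs_add_le _ _).trans (add_le_add h₁ h₂)

/-- An integral over `ℝ ∖ {0}` folds onto the positive half-line. -/
theorem integral_compl_zero_eq_add {g : ℝ → ℝ} (hp : IntegrableOn g (Ioi 0))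
    (hm : IntegrableOn (fun y => g (-y)) (Ioi 0)) :
    ∫ y in {(0 : ℝ)}ᶜ, g y = (∫ y in Ioi 0, g y) + ∫ y in Ioi 0, g (-y) := by
  have hm' : IntegrableOn g (Iio 0) := by
    simpa using hm.comp_neg
  rw [← Iio_union_Ioi, setIntegral_union (Iio_disjoint_Ioi_of_not_lt (lt_irrefl _)) measurableSet_Ioi hm' hp,
    integral_comp_neg_Ioi, neg_zero, integral_Iic_eq_integral_Iio, add_comm]

/-- Let `ν₊, ν₋` satisfy (H0), `a < b`, and let `ν(x,y) = ν₊(x,y)` for `y > 0`,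
`ν(x,y) = ν₋(x,−y)` for `y < 0`. Then for every `f` continuously differentiable on `[a,b]`
(with derivative `f'`) and every `x ∈ [a,b]`,
`|(−D^{(ν₊)}_{a+*} f)(x) + (−D^{(ν₋)}_{b−*} f)(x)| ≤ ‖f′‖_∞ · ∫_{ℝ∖{0}} min(|y|, b−a) ν(x,y) dy`. -/
theorem two_sided_caputo_gradient_bound
    (νp νm ν : ℝ → ℝ → ℝ) (hνp : CondH0 νp) (hνm : CondH0 νm)
    (hν : ∀ x y : ℝ, (0 < y → ν x y = νp x y) ∧ (y < 0 → ν x y = νm x (-y)))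
    (a b : ℝ) (hab : a < b)
    (f f' : ℝ → ℝ)
    (hderiv : ∀ t ∈ Set.Icc a b, HasDerivWithinAt f (f' t) (Set.Icc a b) t)
    (hcont : ContinuousOn f' (Set.Icc a b)) :
    ∀ x ∈ Set.Icc a b,
      |DCaputoLeft νp a f x + DCaputoRight νm b f x| ≤
        (⨆ z : Set.Icc a b, |f' (z : ℝ)|) *
          ∫ y in {(0 : ℝ)}ᶜ, min |y| (b - a) * ν x y := by
  intro x hx
  have hD : 0 < b - a := sub_pos.2 hab
  set L := ⨆ z : Icc a b, |f' (z : ℝ)|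
  have hbdd : BddAbove (range fun z : Icc a b => |f' (z : ℝ)|) := by
    have h := isCompact_Icc.bddAbove_image hcont.abs
    rwa [image_eq_range] at h
  have hfL : ∀ z ∈ Icc a b, ‖f' z‖ ≤ L := fun z hz => le_ciSup hbdd ⟨z, hz⟩
  have hL : 0 ≤ L := Real.iSup_nonneg fun _ => abs_nonneg _
  have hlip : ∀ y ∈ Icc a b, |f y - f x| ≤ L * |y - x| := fun y hy =>
    (convex_Icc a b).norm_image_sub_le_of_norm_hasDerivWithin_le hderiv hfL hx hy
  have hleft : |DCaputoLeft νp a f x| ≤ L * ∫ y in Ioi 0, min |y| (b - a) * νp x y := by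
    refine abs_integral_Ioc_add_integral_Ioi_le (fun y hy => hνp.nonneg x y hy.ne')
      (hνp.integrableOn_min_mul x hD) hL (sub_nonneg.2 hx.1) (by linarith [hx.2])
      (fun y hy => ?_) ?_
    · have h := hlip (x - y) ⟨by linarith [hy.2], by linarith [hy.1, hx.2]⟩
      rwa [sub_sub_cancel_left, abs_neg, abs_of_pos hy.1] at h
    · have h := hlip a (left_mem_Icc.2 hab.le)
      rwa [abs_sub_comm a x, abs_of_nonneg (sub_nonneg.2 hx.1)] at h
  have hright : |DCaputoRight νm b f x| ≤ L * ∫ y in Ioi 0, min |y| (b - a) * νm x y := by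
    refine abs_integral_Ioc_add_integral_Ioi_le (fun y hy => hνm.nonneg x y hy.ne')
      (hνm.integrableOn_min_mul x hD) hL (sub_nonneg.2 hx.2) (by linarith [hx.1])
      (fun y hy => ?_) ?_
    · have h := hlip (x + y) ⟨by linarith [hy.1, hx.1], by linarith [hy.2]⟩
      rwa [add_sub_cancel_left, abs_of_pos hy.1] at h
    · have h := hlip b (right_mem_Icc.2 hab.le)
      rwa [abs_of_nonneg (sub_nonneg.2 hx.2)] at h
  have hp : EqOn (fun y => min |y| (b - a) * νp x y) (fun y => min |y| (b - a) * ν x y)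
      (Ioi 0) := fun y hy => by simp only [(hν x y).1 hy]
  have hm : EqOn (fun y => min |y| (b - a) * νm x y) (fun y => min |-y| (b - a) * ν x (-y))
      (Ioi 0) := fun y hy => by
    simp only [(hν x (-y)).2 (neg_neg_iff_pos.2 hy), abs_neg, neg_neg]
  rw [integral_compl_zero_eq_add (g := fun y => min |y| (b - a) * ν x y)
      ((hνp.integrableOn_min_mul x hD).congr_fun hp measurableSet_Ioi)
      ((hνm.integrableOn_min_mul x hD).congr_fun hm measurableSet_Ioi),
    ← setIntegral_congr_fun measurableSet_Ioi hp, ← setIntegral_congr_fun measurableSet_Ioi hm,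
    mul_add]
  exact (abs_add_le _ _).trans (add_le_add hleft hright)
end

section
/- Let ν satisfy condition (H0), let a < b, and let h : [a,b] → ℝ be continuously differentiable. Then (−D^{(ν)}_{a+*} h)(x) → 0 as x → a from the right; that is, the generalized left-sided Caputo type operator of h vanishes continuously at its terminal a. -/
open MeasureTheory Real Set Filter Topology

theorem CondH0.continuousOn_right {ν : ℝ → ℝ → ℝ} (hν : CondH0 ν) (x : ℝ) :
    ContinuousOn (fun y => ν x y) {(0 : ℝ)}ᶜ :=
  hν.contOn.comp (f := fun y : ℝ => (x, y)) (by fun_prop) (fun y hy => hy)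

theorem measurableSet_ne_zero_abs_le (δ : ℝ) : MeasurableSet {y : ℝ | y ≠ 0 ∧ |y| ≤ δ} :=
  (measurableSet_singleton (0 : ℝ)).compl.inter
    (measurableSet_le continuous_abs.measurable measurable_const)

theorem abs_le_max_mul_min {y δ : ℝ} (hy : |y| ≤ δ) : |y| ≤ max 1 δ * min 1 |y| := by
  rcases le_total 1 |y| with h1 | h1
  · rw [min_eq_left h1, mul_one]
    exact hy.trans (le_max_right _ _)
  · rw [min_eq_right h1]
    exact le_mul_of_one_le_left (abs_nonneg y) (le_max_left _ _)

theorem CondH0.integrableOn_small_jumps {ν : ℝ → ℝ → ℝ} (hν : CondH0 ν) (x δ : ℝ) :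
    IntegrableOn (fun y => |y| * ν x y) {y : ℝ | y ≠ 0 ∧ |y| ≤ δ} := by
  obtain ⟨M, hM⟩ := hν.moment_bdd
  have hsub : {y : ℝ | y ≠ 0 ∧ |y| ≤ δ} ⊆ {(0 : ℝ)}ᶜ := fun y hy => hy.1
  refine Integrable.mono' (((hM x).1.mono_set hsub).const_mul (max 1 δ)) ?_ ?_
  · exact ((continuous_abs.continuousOn.mul (hν.continuousOn_right x)).mono hsub).aestronglyMeasurable
      (measurableSet_ne_zero_abs_le δ)
  · refine (ae_restrict_iff' (measurableSet_ne_zero_abs_le δ)).2 (ae_of_all _ fun y hy => ?_)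
    have h0 := hν.nonneg x y hy.1
    rw [Real.norm_of_nonneg (mul_nonneg (abs_nonneg y) h0), ← mul_assoc]
    exact mul_le_mul_of_nonneg_right (abs_le_max_mul_min hy.2) h0

/-- A function dominated on `s ⊆ (0, ∞)` by `C * min r y * ν x y` has a small integral over `s`:
jumps of size at most `δ` and jumps larger than `δ` are estimated separately. -/
theorem CondH0.norm_setIntegral_le {ν : ℝ → ℝ → ℝ} (hν : CondH0 ν) {x δ r C M : ℝ}
    (hδ : 0 < δ) (hr : 0 ≤ r) (hC : 0 ≤ C)
    (hM : (∫ y in {(0 : ℝ)}ᶜ, min 1 |y| * ν x y) ≤ M)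
    {s : Set ℝ} (hs : MeasurableSet s) (hs0 : s ⊆ Ioi 0) {g : ℝ → ℝ}
    (hg : ∀ y ∈ s, |g y| ≤ C * min r y * ν x y) :
    |∫ y in s, g y| ≤
      C * ((∫ y in {y : ℝ | y ≠ 0 ∧ |y| ≤ δ}, |y| * ν x y) + r / min 1 δ * M) := by
  obtain ⟨_, hI⟩ := hν.moment_bdd
  have hI := (hI x).1
  have hm : 0 < min 1 δ := lt_min one_pos hδ
  set t : Set ℝ := {y : ℝ | y ≠ 0 ∧ |y| ≤ δ} with ht
  have htm : MeasurableSet t := measurableSet_ne_zero_abs_le δ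
  have htsub : t ⊆ {(0 : ℝ)}ᶜ := fun y hy => hy.1
  have hssub : s ⊆ {(0 : ℝ)}ᶜ := fun y hy => (hs0 hy).ne'
  have hIt : IntegrableOn (t.indicator fun y => |y| * ν x y) {(0 : ℝ)}ᶜ :=
    ((integrable_indicator_iff htm).2 (hν.integrableOn_small_jumps x δ)).integrableOn
  set F : ℝ → ℝ := fun y =>
    C * (t.indicator (fun y => |y| * ν x y) y + r / min 1 δ * (min 1 |y| * ν x y)) with hF
  have hFI : IntegrableOn F {(0 : ℝ)}ᶜ := (hIt.add (hI.const_mul _)).const_mul _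
  have hind : ∀ y, 0 ≤ t.indicator (fun y => |y| * ν x y) y := fun y =>
    indicator_nonneg (fun z hz => mul_nonneg (abs_nonneg z) (hν.nonneg x z hz.1)) y
  have htail : ∀ y ∈ ({(0 : ℝ)}ᶜ : Set ℝ), 0 ≤ r / min 1 δ * (min 1 |y| * ν x y) := fun y hy =>
    mul_nonneg (div_nonneg hr hm.le)
      (mul_nonneg (le_min zero_le_one (abs_nonneg y)) (hν.nonneg x y hy))
  have hgF : ∀ y ∈ s, ‖g y‖ ≤ F y := by
    intro y hy
    have hy0 : 0 < y := hs0 hy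
    have hν0 := hν.nonneg x y hy0.ne'
    refine (hg y hy).trans ?_
    rw [mul_assoc]
    refine mul_le_mul_of_nonneg_left ?_ hC
    by_cases hyδ : y ≤ δ
    · have hyt : y ∈ t := ⟨hy0.ne', by rwa [abs_of_pos hy0]⟩
      rw [indicator_of_mem hyt]
      refine le_add_of_le_of_nonneg ?_ (htail y hy0.ne')
      rw [abs_of_pos hy0]
      exact mul_le_mul_of_nonneg_right (min_le_right _ _) hν0
    · refine le_add_of_nonneg_of_le (hind y) ?_
      rw [← mul_assoc]
      refine mul_le_mul_of_nonneg_right ((min_le_left _ _).trans ?_) hν0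
      rw [abs_of_pos hy0, div_mul_eq_mul_div, le_div_iff₀ hm]
      exact mul_le_mul_of_nonneg_left (min_le_min_left 1 (not_le.1 hyδ).le) hr
  calc |∫ y in s, g y| ≤ ∫ y in s, F y :=
        norm_integral_le_of_norm_le (hFI.mono_set hssub)
          ((ae_restrict_iff' hs).2 (ae_of_all _ hgF))
    _ ≤ ∫ y in {(0 : ℝ)}ᶜ, F y := by
        refine setIntegral_mono_set hFI ?_ hssub.eventuallyLE
        exact (ae_restrict_iff' (measurableSet_singleton _).compl).2
          (ae_of_all _ fun y hy => mul_nonneg hC (add_nonneg (hind y) (htail y hy)))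
    _ = C * ((∫ y in t, |y| * ν x y)
          + r / min 1 δ * ∫ y in {(0 : ℝ)}ᶜ, min 1 |y| * ν x y) := by
        rw [hF, integral_const_mul, integral_add hIt (hI.const_mul _), integral_const_mul,
          setIntegral_indicator htm, inter_eq_right.2 htsub]
    _ ≤ _ := by gcongr

/-- The bound on the operator when `h` is `C`-Lipschitz on `[a, x]`. -/
theorem CondH0.abs_dCaputoLeft_le {ν : ℝ → ℝ → ℝ} (hν : CondH0 ν) {a x δ C M : ℝ} {h : ℝ → ℝ}
    (hax : a ≤ x) (hδ : 0 < δ) (hC : 0 ≤ C)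
    (hM : (∫ y in {(0 : ℝ)}ᶜ, min 1 |y| * ν x y) ≤ M)
    (hh : ∀ t ∈ Icc a x, |h t - h x| ≤ C * (x - t)) :
    |DCaputoLeft ν a h x| ≤ 2 * (C *
      ((∫ y in {y : ℝ | y ≠ 0 ∧ |y| ≤ δ}, |y| * ν x y) + (x - a) / min 1 δ * M)) := by
  have hr : 0 ≤ x - a := sub_nonneg.2 hax
  rw [DCaputoLeft, two_mul]
  refine (abs_add_le _ _).trans (add_le_add ?_ ?_)
  · refine hν.norm_setIntegral_le hδ hr hC hM measurableSet_Ioc (fun y hy => hy.1) fun y hy => ?_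
    have hν0 := hν.nonneg x y hy.1.ne'
    rw [min_eq_right hy.2, abs_mul, abs_of_nonneg hν0]
    refine mul_le_mul_of_nonneg_right ?_ hν0
    simpa using hh (x - y) ⟨by linarith [hy.2], by linarith [hy.1]⟩
  · refine hν.norm_setIntegral_le hδ hr hC hM measurableSet_Ioi
      (fun y hy => hr.trans_lt hy) fun y hy => ?_
    have hν0 := hν.nonneg x y (hr.trans_lt hy).ne'
    rw [min_eq_left (le_of_lt hy), abs_mul, abs_of_nonneg hν0]
    exact mul_le_mul_of_nonneg_right (hh a ⟨le_rfl, hax⟩) hν0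

/-- Under condition (H0), for `h` continuously differentiable on `[a,b]`
(with derivative `h'`), the generalized left-sided Caputo type operator of `h` vanishes
continuously at its terminal: `(−D^{(ν)}_{a+*} h)(x) → 0` as `x → a⁺`. -/
theorem generalized_caputo_left_vanishes_at_terminal
    (ν : ℝ → ℝ → ℝ) (hν : CondH0 ν)
    (a b : ℝ) (hab : a < b)
    (h h' : ℝ → ℝ)
    (hderiv : ∀ t ∈ Set.Icc a b, HasDerivWithinAt h (h' t) (Set.Icc a b) t)
    (hcont : ContinuousOn h' (Set.Icc a b)) :
    Tendsto (fun x => DCaputoLeft ν a h x) (𝓝[>] a) (𝓝 0) := by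
  obtain ⟨C, hC⟩ := isCompact_Icc.exists_bound_of_continuousOn hcont
  have hC0 : 0 ≤ C := (norm_nonneg _).trans (hC a (left_mem_Icc.2 hab.le))
  have hlip : ∀ x ∈ Icc a b, ∀ t ∈ Icc a x, |h t - h x| ≤ C * (x - t) := by
    intro x hx t ht
    have := (convex_Icc a b).norm_image_sub_le_of_norm_hasDerivWithin_le hderiv hC hx
      (y := t) ⟨ht.1, ht.2.trans hx.2⟩
    rwa [Real.norm_eq_abs, Real.norm_eq_abs, abs_sub_comm t x,
      abs_of_nonneg (sub_nonneg.2 ht.2)] at this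
  obtain ⟨M, hM⟩ := hν.moment_bdd
  rw [Metric.tendsto_nhds]
  intro ε hε
  have hε' : 0 < ε / (4 * (C + 1)) := by positivity
  obtain ⟨δ, hδ, hsmall⟩ := hν.small_jumps _ hε'
  have htail : Tendsto (fun x => (x - a) / min 1 δ * M) (𝓝[>] a) (𝓝 0) := by
    have hc : Continuous fun x : ℝ => (x - a) / min 1 δ * M := by fun_prop
    simpa using (hc.tendsto a).mono_left nhdsWithin_le_nhds
  filter_upwards [htail.eventually_lt_const hε', Ioc_mem_nhdsGT hab] with x hx hxab
  rw [dist_zero_right, Real.norm_eq_abs]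
  have hbound := hν.abs_dCaputoLeft_le hxab.1.le hδ hC0 (hM x).2
    (hlip x ⟨hxab.1.le, hxab.2⟩)
  have hsum := add_lt_add (hsmall x) hx
  calc |DCaputoLeft ν a h x| ≤ _ := hbound
    _ ≤ 2 * (C * (ε / (4 * (C + 1)) + ε / (4 * (C + 1)))) := by gcongr
    _ = C / (C + 1) * ε := by field_simp; ring
    _ < 1 * ε := by
        refine mul_lt_mul_of_pos_right ?_ hε
        rw [div_lt_one (by positivity)]
        exact lt_add_one C
    _ = ε := one_mul ε
end

section
/- Let ν₊ and ν₋ satisfy condition (H0), let a < b, let α : [a,b] → ℝ be continuous with α(x) > 0 for all x ∈ [a,b], and let γ : [a,b] → ℝ be continuous with γ(a) = 0. For w ∈ (0,1) define f_w(x) = (x−a)^w on [a,b]. Then there exist w ∈ (0,1) and c ∈ (a,b) such that for every x ∈ (a,c): (−D^{(ν₊)}_{a+*} f_w)(x) + (−D^{(ν₋)}_{b−*} f_w)(x) + γ(x) · w (x−a)^{w−1} + α(x) · w(w−1) (x−a)^{w−2} < 0. (This is the Lyapunov-function inequality establishing regularity in expectation of the boundary point a.) -/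
open MeasureTheory Real Set Filter Topology

/-- A weighted integral against a kernel satisfying (H0) is controlled by the truncated first
moment, as soon as the weight is dominated by a multiple of `min 1 |y|`. -/
theorem CondH0.setIntegral_mul_le {ν : ℝ → ℝ → ℝ} (hν : CondH0 ν) {M x K : ℝ} {s : Set ℝ}
    (hs : MeasurableSet s) (hs0 : s ⊆ {(0 : ℝ)}ᶜ)
    (hint : IntegrableOn (fun y => min 1 |y| * ν x y) {(0 : ℝ)}ᶜ volume)
    (hM : (∫ y in {(0 : ℝ)}ᶜ, min 1 |y| * ν x y) ≤ M) (hK : 0 ≤ K) {g : ℝ → ℝ}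
    (hg0 : ∀ y ∈ s, 0 ≤ g y) (hg : ∀ y ∈ s, g y ≤ K * min 1 |y|) :
    (∫ y in s, g y * ν x y) ≤ K * M := by
  have hnn : ∀ y ∈ ({(0 : ℝ)}ᶜ : Set ℝ), 0 ≤ min 1 |y| * ν x y := fun y hy =>
    mul_nonneg (le_min zero_le_one (abs_nonneg y)) (hν.nonneg x y hy)
  calc (∫ y in s, g y * ν x y)
      ≤ ∫ y in s, K * (min 1 |y| * ν x y) := by
        refine integral_mono_of_nonneg ?_ ((hint.mono_set hs0).const_mul K) ?_
        · filter_upwards [ae_restrict_mem hs] with y hy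
          exact mul_nonneg (hg0 y hy) (hν.nonneg x y (hs0 hy))
        · filter_upwards [ae_restrict_mem hs] with y hy
          have h := mul_le_mul_of_nonneg_right (hg y hy) (hν.nonneg x y (hs0 hy))
          simpa [mul_assoc] using h
    _ = K * ∫ y in s, min 1 |y| * ν x y := integral_const_mul _ _
    _ ≤ K * M := by
        refine mul_le_mul_of_nonneg_left (le_trans ?_ hM) hK
        refine setIntegral_mono_set hint ?_ hs0.eventuallyLE
        filter_upwards [ae_restrict_mem (measurableSet_singleton (0 : ℝ)).compl] with y hy
        exact hnn y hy

/-- The left-sided Caputo type operator is nonpositive on functions that are monotone on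
`[a, x]`. -/
theorem CondH0.dCaputoLeft_nonpos {ν : ℝ → ℝ → ℝ} (hν : CondH0 ν) {a x : ℝ} (hx : a ≤ x)
    {h : ℝ → ℝ} (hh : MonotoneOn h (Icc a x)) : DCaputoLeft ν a h x ≤ 0 := by
  refine add_nonpos (setIntegral_nonpos measurableSet_Ioc fun y hy => ?_)
    (setIntegral_nonpos measurableSet_Ioi fun y hy => ?_)
  · refine mul_nonpos_of_nonpos_of_nonneg (sub_nonpos.2 ?_) (hν.nonneg x y hy.1.ne')
    exact hh ⟨by linarith [hy.2], by linarith [hy.1]⟩ ⟨hx, le_rfl⟩ (by linarith [hy.1])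
  · refine mul_nonpos_of_nonpos_of_nonneg (sub_nonpos.2 ?_)
      (hν.nonneg x y ((sub_nonneg.2 hx).trans_lt hy).ne')
    exact hh ⟨le_rfl, hx⟩ ⟨hx, le_rfl⟩ hx

theorem sqrt_add_sub_sqrt_le {t y : ℝ} (ht : 0 < t) (hy : 0 ≤ y) :
    √(t + y) - √t ≤ y / √t := by
  have hs := sqrt_pos.2 ht
  rw [le_div_iff₀ hs]
  nlinarith [sq_sqrt ht.le, sq_sqrt (add_nonneg ht.le hy), sqrt_le_sqrt (by linarith : t ≤ t + y)]

/-- Near the terminal `a`, the right-sided Caputo type operator applied to `z ↦ √(z - a)` grows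
at most like `1 / √(x - a)`. -/
theorem CondH0.exists_dCaputoRight_sqrt_le {ν : ℝ → ℝ → ℝ} (hν : CondH0 ν) {a b : ℝ}
    (hab : a < b) :
    ∃ C : ℝ, ∀ x : ℝ, a < x → x ≤ a + (b - a) / 2 → x ≤ a + 1 →
      DCaputoRight ν b (fun z => √(z - a)) x ≤ C / √(x - a) := by
  obtain ⟨M, hM⟩ := hν.moment_bdd
  have hL : 0 < b - a := sub_pos.2 hab
  have hm : 0 < min 1 ((b - a) / 2) := lt_min one_pos (half_pos hL)
  refine ⟨max 1 (b - a) * M + √(b - a) / min 1 ((b - a) / 2) * M, fun x hx hx2 hx1 => ?_⟩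
  have ht : 0 < x - a := sub_pos.2 hx
  have hs : 0 < √(x - a) := sqrt_pos.2 ht
  have hs1 : √(x - a) ≤ 1 := sqrt_le_one.2 (by linarith)
  obtain ⟨hint, hMx⟩ := hM x
  have hM0 : 0 ≤ M := le_trans (setIntegral_nonneg (measurableSet_singleton (0 : ℝ)).compl
    fun y hy => mul_nonneg (le_min zero_le_one (abs_nonneg y)) (hν.nonneg x y hy)) hMx
  have near : (∫ y in Ioc 0 (b - x), (√(x + y - a) - √(x - a)) * ν x y)
      ≤ max 1 (b - a) / √(x - a) * M := by
    refine hν.setIntegral_mul_le measurableSet_Ioc (fun y hy => hy.1.ne') hint hMx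
      (by positivity) (fun y hy => ?_) (fun y hy => ?_)
    · exact sub_nonneg.2 (sqrt_le_sqrt (by linarith [hy.1]))
    · have h := sqrt_add_sub_sqrt_le ht hy.1.le
      rw [show x - a + y = x + y - a by ring] at h
      refine h.trans ?_
      rw [div_mul_eq_mul_div, abs_of_pos hy.1]
      gcongr
      rcases le_total 1 y with h1 | h1
      · rw [min_eq_left h1, mul_one]
        exact le_max_of_le_right (by linarith [hy.2])
      · rw [min_eq_right h1]
        exact le_mul_of_one_le_left hy.1.le (le_max_left _ _)
  have far : (∫ y in Ioi (b - x), (√(b - a) - √(x - a)) * ν x y)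
      ≤ √(b - a) / min 1 ((b - a) / 2) * M := by
    have hy0 : ∀ y ∈ Ioi (b - x), (b - a) / 2 ≤ y := fun y hy => by
      have := mem_Ioi.1 hy
      linarith
    refine hν.setIntegral_mul_le measurableSet_Ioi
      (fun y hy => ((half_pos hL).trans_le (hy0 y hy)).ne') hint hMx
      (by positivity) (fun y _ => ?_) (fun y hy => ?_)
    · exact sub_nonneg.2 (sqrt_le_sqrt (by linarith))
    · have h : min 1 ((b - a) / 2) ≤ min 1 |y| :=
        min_le_min le_rfl ((hy0 y hy).trans (le_abs_self y))
      calc √(b - a) - √(x - a) ≤ √(b - a) := by linarith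
        _ = √(b - a) / min 1 ((b - a) / 2) * min 1 ((b - a) / 2) := by field_simp
        _ ≤ _ := by gcongr
  rw [add_div]
  refine add_le_add (near.trans_eq (by ring)) (far.trans (le_div_self (by positivity) hs hs1))

/-- (Lyapunov-function inequality for regularity of the boundary point `a`.)
Let `ν₊, ν₋` satisfy (H0), `a < b`, `α` continuous and positive on `[a,b]`, `γ` continuous on
`[a,b]` with `γ(a) = 0`. Then there exist `w ∈ (0,1)` and `c ∈ (a,b)` such that for every
`x ∈ (a,c)`, with `f_w(z) = (z−a)^w`,
`(−D^{(ν₊)}_{a+*} f_w)(x) + (−D^{(ν₋)}_{b−*} f_w)(x)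
   + γ(x)·w(x−a)^{w−1} + α(x)·w(w−1)(x−a)^{w−2} < 0`. -/
theorem lyapunov_inequality_at_lower_boundary
    (νp νm : ℝ → ℝ → ℝ) (hνp : CondH0 νp) (hνm : CondH0 νm)
    (a b : ℝ) (hab : a < b)
    (α γ : ℝ → ℝ)
    (hα : ContinuousOn α (Set.Icc a b)) (hαpos : ∀ x ∈ Set.Icc a b, 0 < α x)
    (hγ : ContinuousOn γ (Set.Icc a b)) (hγa : γ a = 0) :
    ∃ w ∈ Set.Ioo (0 : ℝ) 1, ∃ c ∈ Set.Ioo a b, ∀ x ∈ Set.Ioo a c,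
      DCaputoLeft νp a (fun z => (z - a) ^ w) x
        + DCaputoRight νm b (fun z => (z - a) ^ w) x
        + γ x * (w * (x - a) ^ (w - 1))
        + α x * (w * (w - 1) * (x - a) ^ (w - 2)) < 0 := by
  obtain ⟨C, hC⟩ := hνm.exists_dCaputoRight_sqrt_le hab
  obtain ⟨x₀, hx₀, hmin⟩ := isCompact_Icc.exists_isMinOn (nonempty_Icc.2 hab.le) hα
  obtain ⟨G, hG⟩ := isCompact_Icc.exists_bound_of_continuousOn hγ
  have hα₀ := hαpos x₀ hx₀
  have hL : 0 < b - a := sub_pos.2 hab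
  set K : ℝ := |C + G / 2| + 1
  have hK : 0 < K := by positivity
  have hKle : C + G / 2 ≤ K := (le_abs_self _).trans (by simp [K])
  have hr : 0 < min (min ((b - a) / 2) 1) (α x₀ / (4 * K)) := by positivity
  refine ⟨1 / 2, by norm_num, a + min (min ((b - a) / 2) 1) (α x₀ / (4 * K)),
    ⟨by linarith, ?_⟩, fun x hx => ?_⟩
  · have : min (min ((b - a) / 2) 1) (α x₀ / (4 * K)) ≤ (b - a) / 2 :=
      (min_le_left _ _).trans (min_le_left _ _)
    linarith
  obtain ⟨hax, hxc⟩ := hx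
  rw [← sub_lt_iff_lt_add', lt_min_iff, lt_min_iff] at hxc
  obtain ⟨⟨hx2, hx1⟩, hxK⟩ := hxc
  have ht : 0 < x - a := sub_pos.2 hax
  have hs : 0 < √(x - a) := sqrt_pos.2 ht
  have hsq : √(x - a) ^ 2 = x - a := sq_sqrt ht.le
  have hxI : x ∈ Icc a b := ⟨hax.le, by linarith⟩
  have hpow1 : (x - a) ^ ((1 : ℝ) / 2 - 1) = 1 / √(x - a) := by
    rw [show (1 : ℝ) / 2 - 1 = -(1 / 2) by norm_num, rpow_neg ht.le, ← sqrt_eq_rpow, one_div]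
  have hpow2 : (x - a) ^ ((1 : ℝ) / 2 - 2) = 1 / (√(x - a) * (x - a)) := by
    rw [show (1 : ℝ) / 2 - 2 = 1 / 2 - 1 - 1 by norm_num, rpow_sub_one ht.ne', hpow1, div_div]
  rw [hpow1, hpow2]
  simp only [← sqrt_eq_rpow]
  have hleft : DCaputoLeft νp a (fun z => √(z - a)) x ≤ 0 :=
    hνp.dCaputoLeft_nonpos hax.le fun u _ v _ huv => sqrt_le_sqrt (by linarith)
  have hright := hC x hax (by linarith) (by linarith)
  have hγx : γ x ≤ G := (le_abs_self _).trans (hG x hxI)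
  have hαx : α x₀ ≤ α x := hmin hxI
  have hKt : K * (x - a) < α x / 4 := by
    rw [lt_div_iff₀ (by positivity)] at hxK
    linarith
  have hsum : C / √(x - a) + γ x * (1 / 2 * (1 / √(x - a)))
      + α x * (1 / 2 * (1 / 2 - 1) * (1 / (√(x - a) * (x - a))))
      = ((C + γ x / 2) * (x - a) - α x / 4) / (√(x - a) * (x - a)) := by
    field_simp
    ring
  have hneg : ((C + γ x / 2) * (x - a) - α x / 4) / (√(x - a) * (x - a)) < 0 := by
    refine div_neg_of_neg_of_pos ?_ (mul_pos hs ht)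
    have : (C + γ x / 2) * (x - a) ≤ K * (x - a) :=
      mul_le_mul_of_nonneg_right (by linarith) ht.le
    linarith
  linarith
end

section
/- Let β ∈ (0,1) and define w(x) = (1−x²)^{β/2} for x ∈ [−1,1]. Then w(−1) = w(1) = 0, and the function x ↦ (D^β_{−1+*} w)(x) + (D^β_{1−*} w)(x) is well defined (all integrals converge absolutely) and constant on (−1,1); i.e., there is a constant C_β such that for all x ∈ (−1,1), (D^β_{−1+*} w)(x) + (D^β_{1−*} w)(x) = C_β. Consequently, a suitable positive multiple of w solves the two-sided Caputo fractional boundary value problem D^β_{−1+*} u + D^β_{1−*} u = 1 on (−1,1) with u(−1) = u(1) = 0. -/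
open MeasureTheory Real Set Filter Topology

/-- The classical left-sided Caputo fractional derivative of order `β` with terminal `a`:
`(D^β_{a+*} h)(x) = (1/Γ(1−β)) ∫_a^x (x−t)^{−β} h′(t) dt`. -/
noncomputable def caputoL (β a : ℝ) (h : ℝ → ℝ) (x : ℝ) : ℝ :=
  (1 / Real.Gamma (1 - β)) * ∫ t in Set.Ioc a x, (x - t) ^ (-β) * deriv h t

/-- The classical right-sided Caputo fractional derivative of order `β` with terminal `b`:
`(D^β_{b−*} h)(x) = −(1/Γ(1−β)) ∫_x^b (t−x)^{−β} h′(t) dt`. -/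
noncomputable def caputoR (β b : ℝ) (h : ℝ → ℝ) (x : ℝ) : ℝ :=
  -((1 / Real.Gamma (1 - β)) * ∫ t in Set.Ico x b, (t - x) ^ (-β) * deriv h t)

theorem integrableOn_rpow_mul_one_sub_sq_rpow {β : ℝ} (hβ : β ∈ Ioo (0 : ℝ) 1) :
    IntegrableOn (fun s : ℝ => s ^ (-β) * (1 - s ^ 2) ^ (β / 2 - 1)) (Ioo 0 1) := by
  obtain ⟨h0, h1⟩ := hβ
  have h := Complex.betaIntegral_convergent (u := ((1 - β : ℝ) : ℂ)) (v := ((β / 2 : ℝ) : ℂ))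
    (by rw [Complex.ofReal_re]; linarith) (by rw [Complex.ofReal_re]; linarith)
  rw [intervalIntegrable_iff_integrableOn_Ioo_of_le zero_le_one] at h
  have hc : ContinuousOn (fun s : ℝ => (1 + s) ^ (β / 2 - 1)) (Icc 0 1) := by
    refine ContinuousOn.rpow_const (by fun_prop) fun s hs => Or.inl ?_
    linarith [hs.1]
  refine (IntegrableOn.mul_continuousOn_of_subset h.norm hc measurableSet_Ioo isCompact_Icc
    Ioo_subset_Icc_self).congr_fun (fun s hs => ?_) measurableSet_Ioo
  have hs1 : 0 < 1 - s := by linarith [hs.2]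
  have e : (1 - (s : ℂ)) = ((1 - s : ℝ) : ℂ) := by push_cast; rfl
  simp only
  rw [norm_mul, e, Complex.norm_cpow_eq_rpow_re_of_pos hs.1,
    Complex.norm_cpow_eq_rpow_re_of_pos hs1, mul_assoc, ← Complex.ofReal_one,
    ← Complex.ofReal_sub, ← Complex.ofReal_sub, Complex.ofReal_re, Complex.ofReal_re,
    ← Real.mul_rpow hs1.le (by linarith [hs.1])]
  congr 2 <;> ring

theorem image_mobius_Ioo {x : ℝ} (hx : x ∈ Ioo (-1 : ℝ) 1) :
    (fun s => (s + x) / (1 + x * s)) '' Ioo 0 1 = Ioo x 1 := by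
  obtain ⟨h0, h1⟩ := hx
  ext t
  constructor
  · rintro ⟨s, ⟨hs0, hs1⟩, rfl⟩
    have hd : 0 < 1 + x * s := by nlinarith
    constructor
    · rw [lt_div_iff₀ hd]; nlinarith [mul_pos (sub_pos.2 h1) (neg_lt_iff_pos_add.1 h0)]
    · rw [div_lt_one hd]; nlinarith
  · rintro ⟨ht0, ht1⟩
    have hd : 0 < 1 - x * t := by nlinarith
    have ha : 0 < 1 - x ^ 2 := by nlinarith
    refine ⟨(t - x) / (1 - x * t), ⟨div_pos (by linarith) hd, ?_⟩, ?_⟩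
    · rw [div_lt_one hd]; nlinarith
    · have e : 1 + x * ((t - x) / (1 - x * t)) = (1 - x ^ 2) / (1 - x * t) := by
        field_simp; ring
      simp only
      rw [e, div_eq_iff (by positivity)]
      generalize hd' : 1 - x * t = d at *
      field_simp
      rw [← hd']
      ring

theorem injOn_mobius_Ioo {x : ℝ} (hx : x ∈ Ioo (-1 : ℝ) 1) :
    InjOn (fun s => (s + x) / (1 + x * s)) (Ioo 0 1) := by
  obtain ⟨h0, h1⟩ := hx
  rintro s ⟨hs0, hs1⟩ t ⟨ht0, ht1⟩ h
  have hd : 0 < 1 + x * s := by nlinarith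
  have hd' : 0 < 1 + x * t := by nlinarith
  have ha : 1 - x ^ 2 ≠ 0 := by nlinarith
  simp only at h
  rw [div_eq_div_iff hd.ne' hd'.ne'] at h
  apply mul_left_cancel₀ ha
  linear_combination h

theorem hasDerivAt_mobius {x s : ℝ} (hd : 1 + x * s ≠ 0) :
    HasDerivAt (fun s => (s + x) / (1 + x * s)) ((1 - x ^ 2) / (1 + x * s) ^ 2) s := by
  have h := ((hasDerivAt_id s).add_const x).div (((hasDerivAt_id s).const_mul x).const_add 1) hd
  refine h.congr_deriv ?_
  simp only [id]
  ring

theorem mobius_integrand_eq {β x s : ℝ} (hx : x ∈ Ioo (-1 : ℝ) 1) (hs : s ∈ Ioo (0 : ℝ) 1) :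
    |(1 - x ^ 2) / (1 + x * s) ^ 2| • (((s + x) / (1 + x * s) - x) ^ (-β) *
      ((s + x) / (1 + x * s) * (1 - ((s + x) / (1 + x * s)) ^ 2) ^ (β / 2 - 1))) =
    (1 - x ^ 2) ^ (-β / 2) *
      (s ^ (-β) * (1 - s ^ 2) ^ (β / 2 - 1) * ((s + x) / (1 + x * s))) := by
  obtain ⟨h0, h1⟩ := hx
  obtain ⟨hs0, hs1⟩ := hs
  have hd : 0 < 1 + x * s := by nlinarith
  have ha : 0 < 1 - x ^ 2 := by nlinarith
  have hq : 0 < 1 - s ^ 2 := by nlinarith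
  have e1 : (s + x) / (1 + x * s) - x = s * (1 - x ^ 2) / (1 + x * s) := by
    rw [eq_div_iff hd.ne', sub_mul, div_mul_cancel₀ _ hd.ne']
    ring
  have e2 : 1 - ((s + x) / (1 + x * s)) ^ 2 = (1 - x ^ 2) * (1 - s ^ 2) / (1 + x * s) ^ 2 := by
    rw [eq_div_iff (by positivity), div_pow, sub_mul, div_mul_cancel₀ _ (by positivity)]
    ring
  rw [e1, e2, abs_of_pos (by positivity), smul_eq_mul]
  generalize (s + x) / (1 + x * s) = y
  generalize 1 + x * s = d at *
  generalize 1 - x ^ 2 = a at *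
  generalize 1 - s ^ 2 = q at *
  have key : a / d ^ 2 * ((s * a / d) ^ (-β) * (a * q / d ^ 2) ^ (β / 2 - 1)) =
      a ^ (-β / 2) * (s ^ (-β) * q ^ (β / 2 - 1)) := by
    have e : a / d ^ 2 = Real.exp (Real.log a - 2 * Real.log d) := by
      rw [← Real.exp_log (show 0 < a / d ^ 2 by positivity), Real.log_div ha.ne' (by positivity),
        Real.log_pow]
      norm_num
    rw [Real.rpow_def_of_pos (by positivity), Real.rpow_def_of_pos (by positivity),
      Real.rpow_def_of_pos ha, Real.rpow_def_of_pos hs0, Real.rpow_def_of_pos hq, e,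
      Real.log_div (by positivity) hd.ne', Real.log_mul hs0.ne' ha.ne',
      Real.log_div (by positivity) (by positivity), Real.log_mul ha.ne' hq.ne', Real.log_pow]
    simp only [← Real.exp_add]
    congr 1
    push_cast
    ring
  linear_combination y * key

theorem integrableOn_mul_mobius {β x : ℝ} (hβ : β ∈ Ioo (0 : ℝ) 1) (hx : x ∈ Ioo (-1 : ℝ) 1) :
    IntegrableOn (fun s : ℝ => s ^ (-β) * (1 - s ^ 2) ^ (β / 2 - 1) * ((s + x) / (1 + x * s)))
      (Ioo 0 1) := by
  refine (integrableOn_rpow_mul_one_sub_sq_rpow hβ).mul_continuousOn_of_subset (K := Icc 0 1)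
    (ContinuousOn.div (by fun_prop) (by fun_prop) fun s hs => ?_) measurableSet_Ioo isCompact_Icc
    Ioo_subset_Icc_self
  obtain ⟨h0, h1⟩ := hx
  obtain ⟨hs0, hs1⟩ := hs
  nlinarith

theorem integrableOn_Ioo_of_mobius {β x : ℝ} (hβ : β ∈ Ioo (0 : ℝ) 1)
    (hx : x ∈ Ioo (-1 : ℝ) 1) :
    IntegrableOn (fun t : ℝ => (t - x) ^ (-β) * (t * (1 - t ^ 2) ^ (β / 2 - 1))) (Ioo x 1) := by
  rw [← image_mobius_Ioo hx, integrableOn_image_iff_integrableOn_abs_deriv_smul measurableSet_Ioo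
    (fun s hs => (hasDerivAt_mobius (x := x) (s := s) ?_).hasDerivWithinAt) (injOn_mobius_Ioo hx)]
  · exact IntegrableOn.congr_fun ((integrableOn_mul_mobius hβ hx).const_mul ((1 - x ^ 2) ^ (-β / 2)))
      (fun s hs => (mobius_integrand_eq hx hs).symm) measurableSet_Ioo
  · nlinarith [hx.1, hx.2, hs.1, hs.2]

theorem integral_Ioo_eq_mobius {β x : ℝ} (hx : x ∈ Ioo (-1 : ℝ) 1) :
    ∫ t in Ioo x 1, (t - x) ^ (-β) * (t * (1 - t ^ 2) ^ (β / 2 - 1)) =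
      (1 - x ^ 2) ^ (-β / 2) *
        ∫ s in Ioo 0 1, s ^ (-β) * (1 - s ^ 2) ^ (β / 2 - 1) * ((s + x) / (1 + x * s)) := by
  rw [← image_mobius_Ioo hx, integral_image_eq_integral_abs_deriv_smul measurableSet_Ioo
    (fun s hs => (hasDerivAt_mobius (x := x) (s := s) ?_).hasDerivWithinAt) (injOn_mobius_Ioo hx),
    ← integral_const_mul]
  · exact setIntegral_congr_fun measurableSet_Ioo fun s hs => mobius_integrand_eq hx hs
  · nlinarith [hx.1, hx.2, hs.1, hs.2]

theorem sqrt_subst_pos {x : ℝ} (hx : x ∈ Ioo (-1 : ℝ) 1) (v : ℝ) :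
    0 < 1 - x ^ 2 + x ^ 2 * v ^ 2 := by
  have : 0 < 1 - x ^ 2 := by nlinarith [hx.1, hx.2]
  positivity

theorem hasDerivAt_div_sqrt {x : ℝ} (hx : x ∈ Ioo (-1 : ℝ) 1) (v : ℝ) :
    HasDerivAt (fun v => v / √(1 - x ^ 2 + x ^ 2 * v ^ 2))
      ((1 - x ^ 2) / √(1 - x ^ 2 + x ^ 2 * v ^ 2) ^ 3) v := by
  have hD := sqrt_subst_pos hx v
  have h1 : HasDerivAt (fun v : ℝ => 1 - x ^ 2 + x ^ 2 * v ^ 2) (x ^ 2 * (2 * v)) v := by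
    simpa using (((hasDerivAt_id v).pow 2).const_mul (x ^ 2)).const_add (1 - x ^ 2)
  have h := (hasDerivAt_id v).div (h1.sqrt hD.ne') (Real.sqrt_pos.2 hD).ne'
  refine h.congr_deriv ?_
  have hs := Real.sqrt_pos.2 hD
  have hq := Real.sq_sqrt hD.le
  generalize √(1 - x ^ 2 + x ^ 2 * v ^ 2) = D at *
  simp only [id]
  field_simp
  linear_combination hq

theorem injOn_div_sqrt {x : ℝ} (hx : x ∈ Ioo (-1 : ℝ) 1) :
    InjOn (fun v => v / √(1 - x ^ 2 + x ^ 2 * v ^ 2)) (Ioo 0 1) := by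
  rintro u ⟨hu, -⟩ v ⟨hv, -⟩ h
  have hU := sqrt_subst_pos hx u
  have hV := sqrt_subst_pos hx v
  have ha : 1 - x ^ 2 ≠ 0 := by nlinarith [hx.1, hx.2]
  have h2 : (u / √(1 - x ^ 2 + x ^ 2 * u ^ 2)) ^ 2 = (v / √(1 - x ^ 2 + x ^ 2 * v ^ 2)) ^ 2 :=
    congrArg (· ^ 2) h
  rw [div_pow, div_pow, Real.sq_sqrt hU.le, Real.sq_sqrt hV.le, div_eq_div_iff hU.ne' hV.ne'] at h2
  have h3 : u ^ 2 = v ^ 2 := by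
    apply mul_left_cancel₀ ha
    linear_combination h2
  exact (pow_left_inj₀ hu.le hv.le two_ne_zero).1 h3

theorem image_div_sqrt_Ioo {x : ℝ} (hx : x ∈ Ioo (-1 : ℝ) 1) :
    (fun v => v / √(1 - x ^ 2 + x ^ 2 * v ^ 2)) '' Ioo 0 1 = Ioo 0 1 := by
  have ha : 0 < 1 - x ^ 2 := by nlinarith [hx.1, hx.2]
  ext s
  constructor
  · rintro ⟨v, ⟨hv0, hv1⟩, rfl⟩
    have hD := sqrt_subst_pos hx v
    refine ⟨div_pos hv0 (Real.sqrt_pos.2 hD), ?_⟩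
    simp only
    rw [div_lt_one (Real.sqrt_pos.2 hD), Real.lt_sqrt hv0.le]
    nlinarith [mul_pos ha (show 0 < 1 - v ^ 2 by nlinarith)]
  · rintro ⟨hs0, hs1⟩
    have hb : 0 < 1 - x ^ 2 * s ^ 2 := by
      nlinarith [mul_nonneg (sq_nonneg x) (show 0 ≤ 1 - s ^ 2 by nlinarith)]
    have hv : 0 < s * √((1 - x ^ 2) / (1 - x ^ 2 * s ^ 2)) :=
      mul_pos hs0 (Real.sqrt_pos.2 (div_pos ha hb))
    have hv2 : (s * √((1 - x ^ 2) / (1 - x ^ 2 * s ^ 2))) ^ 2 =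
        s ^ 2 * ((1 - x ^ 2) / (1 - x ^ 2 * s ^ 2)) := by
      rw [mul_pow, Real.sq_sqrt (div_pos ha hb).le]
    refine ⟨s * √((1 - x ^ 2) / (1 - x ^ 2 * s ^ 2)), ⟨hv, ?_⟩, ?_⟩
    · rw [← sq_lt_one_iff₀ hv.le, hv2, ← mul_div_assoc, div_lt_one hb]
      nlinarith
    · simp only
      rw [hv2]
      have e : 1 - x ^ 2 + x ^ 2 * (s ^ 2 * ((1 - x ^ 2) / (1 - x ^ 2 * s ^ 2))) =
          (1 - x ^ 2) / (1 - x ^ 2 * s ^ 2) := by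
        field_simp; ring
      rw [e, mul_div_cancel_right₀ _ (Real.sqrt_pos.2 (div_pos ha hb)).ne']

theorem div_sqrt_integrand_eq {β x v : ℝ} (hx : x ∈ Ioo (-1 : ℝ) 1) (hv : v ∈ Ioo (0 : ℝ) 1) :
    |(1 - x ^ 2) / √(1 - x ^ 2 + x ^ 2 * v ^ 2) ^ 3| •
      ((v / √(1 - x ^ 2 + x ^ 2 * v ^ 2)) ^ (-β) *
        (1 - (v / √(1 - x ^ 2 + x ^ 2 * v ^ 2)) ^ 2) ^ (β / 2 - 1) *
        (v / √(1 - x ^ 2 + x ^ 2 * v ^ 2) /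
          (1 - x ^ 2 * (v / √(1 - x ^ 2 + x ^ 2 * v ^ 2)) ^ 2))) =
    (1 - x ^ 2) ^ (β / 2 - 1) * (v ^ (-β) * (1 - v ^ 2) ^ (β / 2 - 1) * v) := by
  obtain ⟨hv0, hv1⟩ := hv
  have hD := sqrt_subst_pos hx v
  have ha : 0 < 1 - x ^ 2 := by nlinarith [hx.1, hx.2]
  have hq : 0 < 1 - v ^ 2 := by nlinarith
  have hs := Real.sqrt_pos.2 hD
  have hsq := Real.sq_sqrt hD.le
  generalize √(1 - x ^ 2 + x ^ 2 * v ^ 2) = D at *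
  have e1 : 1 - (v / D) ^ 2 = (1 - x ^ 2) * (1 - v ^ 2) / D ^ 2 := by
    field_simp; linear_combination hsq
  have e2 : 1 - x ^ 2 * (v / D) ^ 2 = (1 - x ^ 2) / D ^ 2 := by
    field_simp; linear_combination hsq
  rw [e1, e2, abs_of_pos (by positivity), smul_eq_mul]
  have e3 : (1 - x ^ 2) / D ^ 3 * ((v / D) ^ (-β) *
      ((1 - x ^ 2) * (1 - v ^ 2) / D ^ 2) ^ (β / 2 - 1) * (v / D / ((1 - x ^ 2) / D ^ 2))) =
      v * (1 / D ^ 2 * ((v / D) ^ (-β) *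
      ((1 - x ^ 2) * (1 - v ^ 2) / D ^ 2) ^ (β / 2 - 1))) := by
    field_simp
  rw [e3]
  generalize 1 - x ^ 2 = a at *
  generalize 1 - v ^ 2 = q at *
  have key : 1 / D ^ 2 * ((v / D) ^ (-β) * (a * q / D ^ 2) ^ (β / 2 - 1)) =
      a ^ (β / 2 - 1) * (v ^ (-β) * q ^ (β / 2 - 1)) := by
    have e : 1 / D ^ 2 = Real.exp (- 2 * Real.log D) := by
      rw [← Real.exp_log (show 0 < 1 / D ^ 2 by positivity), one_div, Real.log_inv,
        Real.log_pow]
      norm_num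
    rw [Real.rpow_def_of_pos (by positivity), Real.rpow_def_of_pos (by positivity),
      Real.rpow_def_of_pos ha, Real.rpow_def_of_pos hv0, Real.rpow_def_of_pos hq, e,
      Real.log_div hv0.ne' hs.ne',
      Real.log_div (by positivity) (by positivity), Real.log_mul ha.ne' hq.ne', Real.log_pow]
    simp only [← Real.exp_add]
    congr 1
    push_cast
    ring
  linear_combination v * key

theorem integral_div_one_sub_sq_eq {β x : ℝ} (hx : x ∈ Ioo (-1 : ℝ) 1) :
    ∫ s in Ioo (0 : ℝ) 1, s ^ (-β) * (1 - s ^ 2) ^ (β / 2 - 1) * (s / (1 - x ^ 2 * s ^ 2)) =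
      (1 - x ^ 2) ^ (β / 2 - 1) *
        ∫ v in Ioo (0 : ℝ) 1, v ^ (-β) * (1 - v ^ 2) ^ (β / 2 - 1) * v := by
  conv_lhs => rw [← image_div_sqrt_Ioo hx]
  rw [integral_image_eq_integral_abs_deriv_smul measurableSet_Ioo
    (fun v _ => (hasDerivAt_div_sqrt hx v).hasDerivWithinAt) (injOn_div_sqrt hx),
    ← integral_const_mul]
  exact setIntegral_congr_fun measurableSet_Ioo fun v hv => div_sqrt_integrand_eq hx hv

theorem integral_Ioo_add_integral_Ioo_neg {β x : ℝ} (hβ : β ∈ Ioo (0 : ℝ) 1)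
    (hx : x ∈ Ioo (-1 : ℝ) 1) :
    (∫ t in Ioo x 1, (t - x) ^ (-β) * (t * (1 - t ^ 2) ^ (β / 2 - 1))) +
      ∫ t in Ioo (-x) 1, (t - -x) ^ (-β) * (t * (1 - t ^ 2) ^ (β / 2 - 1)) =
      2 * ∫ v in Ioo (0 : ℝ) 1, v ^ (-β) * (1 - v ^ 2) ^ (β / 2 - 1) * v := by
  have hx' : -x ∈ Ioo (-1 : ℝ) 1 := ⟨by linarith [hx.2], by linarith [hx.1]⟩
  have ha : 0 < 1 - x ^ 2 := by nlinarith [hx.1, hx.2]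
  rw [integral_Ioo_eq_mobius hx, integral_Ioo_eq_mobius hx', neg_sq, ← mul_add,
    ← integral_add (integrableOn_mul_mobius hβ hx) (integrableOn_mul_mobius hβ hx')]
  have e : ∫ s in Ioo (0 : ℝ) 1, (s ^ (-β) * (1 - s ^ 2) ^ (β / 2 - 1) * ((s + x) / (1 + x * s)) +
      s ^ (-β) * (1 - s ^ 2) ^ (β / 2 - 1) * ((s + -x) / (1 + -x * s))) =
      2 * (1 - x ^ 2) * ∫ s in Ioo (0 : ℝ) 1,
        s ^ (-β) * (1 - s ^ 2) ^ (β / 2 - 1) * (s / (1 - x ^ 2 * s ^ 2)) := by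
    rw [← integral_const_mul]
    refine setIntegral_congr_fun measurableSet_Ioo fun s hs => ?_
    have h1 : 0 < 1 + x * s := by nlinarith [hx.1, hx.2, hs.1, hs.2]
    have h2 : 0 < 1 - x * s := by nlinarith [hx.1, hx.2, hs.1, hs.2]
    have e1 : (1 - x ^ 2 * s ^ 2) = (1 + x * s) * (1 - x * s) := by ring
    have e2 : 1 + -x * s = 1 - x * s := by ring
    rw [e1, e2]
    generalize hc : 1 + x * s = c at *
    generalize hd : 1 - x * s = d at *
    field_simp
    rw [← hc, ← hd]
    ring
  rw [e, integral_div_one_sub_sq_eq hx]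
  have h3 : (1 - x ^ 2) ^ (-β / 2) * ((1 - x ^ 2) * (1 - x ^ 2) ^ (β / 2 - 1)) = 1 := by
    nth_rewrite 2 [← Real.rpow_one (1 - x ^ 2)]
    rw [← Real.rpow_add ha, ← Real.rpow_add ha]
    convert Real.rpow_zero _ using 2
    ring
  linear_combination (2 * ∫ v in Ioo (0 : ℝ) 1, v ^ (-β) * (1 - v ^ 2) ^ (β / 2 - 1) * v) * h3

theorem integral_rpow_mul_one_sub_sq_rpow_mul_pos {β : ℝ} (hβ : β ∈ Ioo (0 : ℝ) 1) :
    0 < ∫ v in Ioo (0 : ℝ) 1, v ^ (-β) * (1 - v ^ 2) ^ (β / 2 - 1) * v := by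
  have hi : IntegrableOn (fun v : ℝ => v ^ (-β) * (1 - v ^ 2) ^ (β / 2 - 1) * v) (Ioo 0 1) :=
    (integrableOn_rpow_mul_one_sub_sq_rpow hβ).mul_continuousOn_of_subset (K := Icc 0 1)
      continuousOn_id measurableSet_Ioo isCompact_Icc Ioo_subset_Icc_self
  rw [← integral_Ioc_eq_integral_Ioo, ← intervalIntegral.integral_of_le zero_le_one]
  refine intervalIntegral.intervalIntegral_pos_of_pos_on
    ((intervalIntegrable_iff_integrableOn_Ioo_of_le zero_le_one).2 hi) (fun v hv => ?_) one_pos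
  have hq : 0 < 1 - v ^ 2 := by nlinarith [hv.1, hv.2]
  have := hv.1
  positivity

theorem deriv_one_sub_sq_rpow {γ t : ℝ} (ht : t ∈ Ioo (-1 : ℝ) 1) :
    deriv (fun x : ℝ => (1 - x ^ 2) ^ (γ / 2)) t = -γ * (t * (1 - t ^ 2) ^ (γ / 2 - 1)) := by
  have hq : 1 - t ^ 2 ≠ 0 := by nlinarith [ht.1, ht.2]
  have h1 : HasDerivAt (fun x : ℝ => 1 - x ^ 2) (-(2 * t)) t := by
    simpa using ((hasDerivAt_id t).pow 2).const_sub 1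
  rw [(h1.rpow_const (p := γ / 2) (Or.inl hq)).deriv]
  ring

theorem right_integrand_eqOn {β x : ℝ} (hx : x ∈ Ioo (-1 : ℝ) 1) :
    EqOn (fun t => -β * ((t - x) ^ (-β) * (t * (1 - t ^ 2) ^ (β / 2 - 1))))
      (fun t => (t - x) ^ (-β) * deriv (fun x : ℝ => (1 - x ^ 2) ^ (β / 2)) t) (Ioo x 1) := by
  intro t ht
  simp only
  rw [deriv_one_sub_sq_rpow ⟨hx.1.trans ht.1, ht.2⟩]
  ring

theorem left_integrand_eqOn {β x : ℝ} (hx : x ∈ Ioo (-1 : ℝ) 1) :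
    EqOn (fun t => β * ((-t - -x) ^ (-β) * (-t * (1 - (-t) ^ 2) ^ (β / 2 - 1))))
      (fun t => (x - t) ^ (-β) * deriv (fun x : ℝ => (1 - x ^ 2) ^ (β / 2)) t) (Ioo (-1) x) := by
  intro t ht
  simp only
  rw [deriv_one_sub_sq_rpow ⟨ht.1, ht.2.trans hx.2⟩, neg_sq, show -t - -x = x - t by ring]
  ring

theorem preimage_neg_Ioo_neg_one (x : ℝ) : Neg.neg ⁻¹' Ioo (-x) 1 = Ioo (-1) x := by
  simp

/-- For `β ∈ (0,1)` and `w(x) = (1−x²)^{β/2}` on `[−1,1]`: `w(±1) = 0`, the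
two-sided Caputo derivative of `w` is well defined (all integrals converge absolutely) and
constant on `(−1,1)`, and a suitable positive multiple of `w` solves
`D^β_{−1+*} u + D^β_{1−*} u = 1` on `(−1,1)` with `u(−1) = u(1) = 0`. -/
theorem two_sided_caputo_of_stable_exit_time
    (β : ℝ) (hβ : β ∈ Set.Ioo (0 : ℝ) 1)
    (w : ℝ → ℝ) (hw : ∀ x : ℝ, w x = (1 - x ^ 2) ^ (β / 2)) :
    w (-1) = 0 ∧ w 1 = 0 ∧
    (∀ x ∈ Set.Ioo (-1 : ℝ) 1,
      IntegrableOn (fun t => (x - t) ^ (-β) * deriv w t) (Set.Ioc (-1) x) volume ∧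
      IntegrableOn (fun t => (t - x) ^ (-β) * deriv w t) (Set.Ico x 1) volume) ∧
    (∃ C : ℝ, ∀ x ∈ Set.Ioo (-1 : ℝ) 1,
      caputoL β (-1) w x + caputoR β 1 w x = C) ∧
    (∃ c : ℝ, 0 < c ∧
      (∀ x ∈ Set.Ioo (-1 : ℝ) 1,
        caputoL β (-1) (fun z => c * w z) x + caputoR β 1 (fun z => c * w z) x = 1) ∧
      c * w (-1) = 0 ∧ c * w 1 = 0) := by
  have hβ2 : β / 2 ≠ 0 := by linarith [hβ.1]
  have w1 : w (-1) = 0 := by rw [hw]; simp [Real.zero_rpow hβ2]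
  have w2 : w 1 = 0 := by rw [hw]; simp [Real.zero_rpow hβ2]
  obtain rfl : w = fun x : ℝ => (1 - x ^ 2) ^ (β / 2) := funext hw
  have hneg : ∀ {x : ℝ}, x ∈ Ioo (-1 : ℝ) 1 → -x ∈ Ioo (-1 : ℝ) 1 :=
    fun hx => ⟨by linarith [hx.2], by linarith [hx.1]⟩
  have hmp := Measure.measurePreserving_neg (volume : Measure ℝ)
  have hme := (MeasurableEquiv.neg ℝ).measurableEmbedding
  have hG : 0 < Real.Gamma (1 - β) := Real.Gamma_pos_of_pos (by linarith [hβ.2])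
  have hK := integral_rpow_mul_one_sub_sq_rpow_mul_pos hβ
  set K := ∫ v in Ioo (0 : ℝ) 1, v ^ (-β) * (1 - v ^ 2) ^ (β / 2 - 1) * v
  have hC : ∀ x ∈ Ioo (-1 : ℝ) 1, caputoL β (-1) (fun x : ℝ => (1 - x ^ 2) ^ (β / 2)) x +
      caputoR β 1 (fun x : ℝ => (1 - x ^ 2) ^ (β / 2)) x =
      1 / Real.Gamma (1 - β) * (β * (2 * K)) := by
    intro x hx
    rw [caputoL, caputoR, integral_Ioc_eq_integral_Ioo, integral_Ico_eq_integral_Ioo,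
      ← setIntegral_congr_fun measurableSet_Ioo (right_integrand_eqOn hx),
      ← setIntegral_congr_fun measurableSet_Ioo (left_integrand_eqOn hx),
      integral_const_mul, integral_const_mul, ← preimage_neg_Ioo_neg_one,
      hmp.setIntegral_preimage_emb hme
        (fun t => (t - -x) ^ (-β) * (t * (1 - t ^ 2) ^ (β / 2 - 1))),
      ← integral_Ioo_add_integral_Ioo_neg hβ hx]
    ring
  have hCpos : 0 < 1 / Real.Gamma (1 - β) * (β * (2 * K)) := by
    have := hβ.1
    positivity
  refine ⟨w1, w2, fun x hx => ⟨?_, ?_⟩, ⟨_, hC⟩, (1 / Real.Gamma (1 - β) * (β * (2 * K)))⁻¹,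
    inv_pos.2 hCpos, fun x hx => ?_, by rw [w1, mul_zero], by rw [w2, mul_zero]⟩
  · rw [integrableOn_Ioc_iff_integrableOn_Ioo]
    refine IntegrableOn.congr_fun (Integrable.const_mul ?_ β) (left_integrand_eqOn hx)
      measurableSet_Ioo
    rw [← preimage_neg_Ioo_neg_one]
    exact (hmp.integrableOn_comp_preimage hme).2 (integrableOn_Ioo_of_mobius hβ (hneg hx))
  · rw [integrableOn_Ico_iff_integrableOn_Ioo]
    exact IntegrableOn.congr_fun ((integrableOn_Ioo_of_mobius hβ hx).const_mul (-β))
      (right_integrand_eqOn hx) measurableSet_Ioo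
  · have h := hC x hx
    simp only [caputoL, caputoR, deriv_const_mul_field, mul_left_comm _ (_⁻¹ : ℝ),
      integral_const_mul] at h ⊢
    rw [← mul_neg, ← mul_add, h, inv_mul_cancel₀ hCpos.ne']
end

section
/- Let β ∈ (0,1) and define h(x) = 2^{1−β} (Γ(β)/Γ(β/2)²) ∫_{−1}^x (1−y²)^{β/2−1} dy for x ∈ [−1,1]. Then h(−1) = 0, h(1) = 1, and for every x ∈ (−1,1) all the defining integrals converge absolutely and (D^β_{−1+*} h)(x) + (D^β_{1−*} h)(x) = 0. -/
open MeasureTheory Real Set Filter Topology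

/-- A product of endpoint powers with exponents above `-1` is integrable. -/
theorem intervalIntegrable_sub_rpow_mul_sub_rpow {r s p q : ℝ} (hr : -1 < r) (hs : -1 < s)
    (hpq : p < q) :
    IntervalIntegrable (fun t => (t - p) ^ r * (q - t) ^ s) volume p q := by
  obtain ⟨m, hpm, hmq⟩ := exists_between hpq
  have h₁ : IntervalIntegrable (fun t => (t - p) ^ r) volume p m := by
    simpa using (intervalIntegral.intervalIntegrable_rpow' (a := 0) (b := m - p) hr).comp_sub_right p
  have h₂ : IntervalIntegrable (fun t => (q - t) ^ s) volume m q := by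
    simpa using (intervalIntegral.intervalIntegrable_rpow' (a := q - m) (b := 0) hs).comp_sub_left q
  refine (h₁.mul_continuousOn ?_).trans (h₂.continuousOn_mul ?_)
  · rw [uIcc_of_le hpm.le]
    exact (by fun_prop : ContinuousOn (fun t : ℝ => q - t) (Icc p m)).rpow_const
      fun t ht => Or.inl (sub_pos.2 (ht.2.trans_lt hmq)).ne'
  · rw [uIcc_of_le hmq.le]
    exact (by fun_prop : ContinuousOn (fun t : ℝ => t - p) (Icc m q)).rpow_const
      fun t ht => Or.inl (sub_pos.2 (hpm.trans_le ht.1)).ne'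

theorem one_sub_sq_rpow_eq_mul {t : ℝ} (ht : t ∈ Icc (-1 : ℝ) 1) (r : ℝ) :
    (1 - t ^ 2) ^ r = (t - -1) ^ r * (1 - t) ^ r := by
  rw [← mul_rpow (by linarith [ht.1]) (by linarith [ht.2])]
  ring_nf

theorem intervalIntegrable_one_sub_sq_rpow {r : ℝ} (hr : -1 < r) :
    IntervalIntegrable (fun t : ℝ => (1 - t ^ 2) ^ r) volume (-1) 1 := by
  refine (intervalIntegrable_sub_rpow_mul_sub_rpow hr hr (by norm_num)).congr fun t ht => ?_
  rw [uIoc_of_le (by norm_num)] at ht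
  exact (one_sub_sq_rpow_eq_mul ⟨ht.1.le, ht.2⟩ r).symm

theorem integrableOn_sub_rpow_mul_one_sub_sq_rpow {r s x : ℝ} (hr : -1 < r) (hs : -1 < s)
    (hx : x ∈ Ioo (-1 : ℝ) 1) :
    IntegrableOn (fun t => (x - t) ^ s * (1 - t ^ 2) ^ r) (Ioo (-1) x) := by
  have hc : ContinuousOn (fun t : ℝ => (1 - t) ^ r) (uIcc (-1) x) := by
    rw [uIcc_of_le hx.1.le]
    exact (by fun_prop : ContinuousOn (fun t : ℝ => 1 - t) (Icc (-1) x)).rpow_const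
      fun t ht => Or.inl (sub_pos.2 (ht.2.trans_lt hx.2)).ne'
  have h := (intervalIntegrable_sub_rpow_mul_sub_rpow hr hs hx.1).mul_continuousOn hc
  rw [intervalIntegrable_iff_integrableOn_Ioo_of_le hx.1.le] at h
  refine h.congr_fun (fun t ht => ?_) measurableSet_Ioo
  simp only [one_sub_sq_rpow_eq_mul ⟨ht.1.le, (ht.2.trans hx.2).le⟩ r]
  ring

theorem integral_rpow_mul_one_sub_rpow {a b : ℝ} (ha : 0 < a) (hb : 0 < b) :
    ∫ u in (0 : ℝ)..1, u ^ (a - 1) * (1 - u) ^ (b - 1) =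
      Real.Gamma a * Real.Gamma b / Real.Gamma (a + b) := by
  have h := Complex.betaIntegral_eq_Gamma_mul_div (a : ℂ) (b : ℂ) (by simpa) (by simpa)
  rw [← Complex.ofReal_add, Complex.Gamma_ofReal, Complex.Gamma_ofReal, Complex.Gamma_ofReal,
    Complex.betaIntegral] at h
  have hcongr : ∫ u in (0 : ℝ)..1, (u : ℂ) ^ ((a : ℂ) - 1) * (1 - (u : ℂ)) ^ ((b : ℂ) - 1) =
      ∫ u in (0 : ℝ)..1, ((u ^ (a - 1) * (1 - u) ^ (b - 1) : ℝ) : ℂ) := by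
    refine intervalIntegral.integral_congr fun u hu => ?_
    rw [uIcc_of_le zero_le_one] at hu
    simp only [Complex.ofReal_mul, Complex.ofReal_cpow hu.1,
      Complex.ofReal_cpow (sub_nonneg.2 hu.2), Complex.ofReal_sub, Complex.ofReal_one]
  rw [hcongr, intervalIntegral.integral_ofReal] at h
  exact_mod_cast h

theorem integral_one_sub_sq_rpow {a : ℝ} (ha : 0 < a) :
    ∫ y in (-1 : ℝ)..1, (1 - y ^ 2) ^ (a - 1) =
      2 ^ (2 * a - 1) * (Real.Gamma a ^ 2 / Real.Gamma (2 * a)) := by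
  have h := intervalIntegral.smul_integral_comp_mul_add (a := 0) (b := 1)
    (fun y : ℝ => (1 - y ^ 2) ^ (a - 1)) 2 (-1)
  norm_num at h
  rw [← h]
  have hcongr : ∫ u in (0 : ℝ)..1, (1 - (2 * u + -1) ^ 2) ^ (a - 1) =
      ∫ u in (0 : ℝ)..1, 4 ^ (a - 1) * (u ^ (a - 1) * (1 - u) ^ (a - 1)) := by
    refine intervalIntegral.integral_congr fun u hu => ?_
    rw [uIcc_of_le zero_le_one] at hu
    have h1u : 0 ≤ 1 - u := sub_nonneg.2 hu.2
    rw [← mul_rpow hu.1 h1u, ← mul_rpow (by norm_num) (mul_nonneg hu.1 h1u)]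
    ring_nf
  have h4 : (2 : ℝ) * 4 ^ (a - 1) = 2 ^ (2 * a - 1) := by
    rw [show (4 : ℝ) = 2 ^ (2 : ℝ) by norm_num, ← rpow_mul two_pos.le]
    nth_rewrite 1 [← rpow_one (2 : ℝ)]
    rw [← rpow_add two_pos]
    ring_nf
  rw [hcongr, intervalIntegral.integral_const_mul, integral_rpow_mul_one_sub_rpow ha ha,
    ← mul_assoc, h4, sq, two_mul a]

/-- The Möbius involution fixing `x` and exchanging `1` and `-1`. -/
noncomputable def swapInvolution (x t : ℝ) : ℝ :=
  (2 * x - (1 + x ^ 2) * t) / (1 + x ^ 2 - 2 * x * t)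

theorem swapInvolution_denom_pos (x : ℝ) {t : ℝ} (ht : t ∈ Ioo (-1 : ℝ) 1) :
    0 < 1 + x ^ 2 - 2 * x * t := by
  nlinarith [sq_nonneg (x - t), mul_pos (sub_pos.2 ht.2) (neg_lt_iff_pos_add.1 ht.1)]

theorem swapInvolution_sub {x t : ℝ} (hD : 1 + x ^ 2 - 2 * x * t ≠ 0) :
    swapInvolution x t - x = (1 - x ^ 2) * (x - t) / (1 + x ^ 2 - 2 * x * t) := by
  rw [swapInvolution]
  field_simp
  ring

theorem one_sub_swapInvolution_sq {x t : ℝ} (hD : 1 + x ^ 2 - 2 * x * t ≠ 0) :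
    1 - swapInvolution x t ^ 2 =
      (1 - x ^ 2) ^ 2 * (1 - t ^ 2) / (1 + x ^ 2 - 2 * x * t) ^ 2 := by
  rw [swapInvolution]
  field_simp
  ring

theorem swapInvolution_mem_Ioo {x t : ℝ} (hx : x ∈ Ioo (-1 : ℝ) 1) (ht : t ∈ Ioo (-1 : ℝ) 1) :
    swapInvolution x t ∈ Ioo (-1 : ℝ) 1 := by
  have hD := swapInvolution_denom_pos x ht
  have h := one_sub_swapInvolution_sq hD.ne'
  have hx2 : 0 < 1 - x ^ 2 := by nlinarith [hx.1, hx.2]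
  have ht2 : 0 < 1 - t ^ 2 := by nlinarith [ht.1, ht.2]
  have hpos : 0 < 1 - swapInvolution x t ^ 2 := h ▸ by positivity
  exact abs_lt.1 ((sq_lt_one_iff_abs_lt_one _).1 (by linarith))

theorem swapInvolution_swapInvolution {x t : ℝ} (hx : x ∈ Ioo (-1 : ℝ) 1)
    (ht : t ∈ Ioo (-1 : ℝ) 1) : swapInvolution x (swapInvolution x t) = t := by
  have hD := (swapInvolution_denom_pos x ht).ne'
  have hD' := (swapInvolution_denom_pos x (swapInvolution_mem_Ioo hx ht)).ne'
  rw [swapInvolution, div_eq_iff hD', swapInvolution]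
  field_simp
  ring

theorem hasDerivAt_swapInvolution {x t : ℝ} (hD : 1 + x ^ 2 - 2 * x * t ≠ 0) :
    HasDerivAt (swapInvolution x) (-((1 - x ^ 2) ^ 2 / (1 + x ^ 2 - 2 * x * t) ^ 2)) t := by
  have h₁ : HasDerivAt (fun t : ℝ => 2 * x - (1 + x ^ 2) * t) (-(1 + x ^ 2)) t := by
    simpa only [id, mul_one] using ((hasDerivAt_id t).const_mul (1 + x ^ 2)).const_sub (2 * x)
  have h₂ : HasDerivAt (fun t : ℝ => 1 + x ^ 2 - 2 * x * t) (-(2 * x)) t := by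
    simpa using ((hasDerivAt_id t).const_mul (2 * x)).const_sub (1 + x ^ 2)
  refine (h₁.div h₂ hD).congr_deriv ?_
  field_simp
  ring

theorem injOn_swapInvolution {x : ℝ} (hx : x ∈ Ioo (-1 : ℝ) 1) :
    InjOn (swapInvolution x) (Ioo (-1) 1) := fun s hs t ht h => by
  rw [← swapInvolution_swapInvolution hx hs, h, swapInvolution_swapInvolution hx ht]

theorem swapInvolution_image_Ioo {x : ℝ} (hx : x ∈ Ioo (-1 : ℝ) 1) :
    swapInvolution x '' Ioo (-1) x = Ioo x 1 := by
  have hx2 : 0 < 1 - x ^ 2 := by nlinarith [hx.1, hx.2]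
  ext u
  constructor
  · rintro ⟨t, ht, rfl⟩
    have ht' : t ∈ Ioo (-1 : ℝ) 1 := ⟨ht.1, ht.2.trans hx.2⟩
    have hD := swapInvolution_denom_pos x ht'
    refine ⟨sub_pos.1 ?_, (swapInvolution_mem_Ioo hx ht').2⟩
    rw [swapInvolution_sub hD.ne']
    exact div_pos (mul_pos hx2 (sub_pos.2 ht.2)) hD
  · intro hu
    have hu' : u ∈ Ioo (-1 : ℝ) 1 := ⟨hx.1.trans hu.1, hu.2⟩
    have hD := swapInvolution_denom_pos x hu'
    refine ⟨swapInvolution x u, ⟨(swapInvolution_mem_Ioo hx hu').1, sub_neg.1 ?_⟩,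
      swapInvolution_swapInvolution hx hu'⟩
    rw [swapInvolution_sub hD.ne']
    exact div_neg_of_neg_of_pos (mul_neg_of_pos_of_neg hx2 (sub_neg.2 hu.1)) hD

/-- The weight `|t - x| ^ (-β) * (1 - t ^ 2) ^ (β / 2 - 1) dt` is invariant under the involution. -/
theorem abs_deriv_mul_comp_swapInvolution {β x t : ℝ} (hx : x ∈ Ioo (-1 : ℝ) 1)
    (ht : t ∈ Ioo (-1) x) :
    |-((1 - x ^ 2) ^ 2 / (1 + x ^ 2 - 2 * x * t) ^ 2)| *
      ((swapInvolution x t - x) ^ (-β) * (1 - swapInvolution x t ^ 2) ^ (β / 2 - 1)) =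
      (x - t) ^ (-β) * (1 - t ^ 2) ^ (β / 2 - 1) := by
  have ht' : t ∈ Ioo (-1 : ℝ) 1 := ⟨ht.1, ht.2.trans hx.2⟩
  have hD := swapInvolution_denom_pos x ht'
  have hx2 : 0 < 1 - x ^ 2 := by nlinarith [hx.1, hx.2]
  have ht2 : 0 < 1 - t ^ 2 := by nlinarith [ht'.1, ht'.2]
  have hxt : 0 < x - t := sub_pos.2 ht.2
  rw [swapInvolution_sub hD.ne', one_sub_swapInvolution_sq hD.ne', abs_neg,
    abs_of_nonneg (by positivity)]
  set k := (1 - x ^ 2) / (1 + x ^ 2 - 2 * x * t) with hk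
  have hkpos : 0 < k := div_pos hx2 hD
  have e₁ : (1 - x ^ 2) ^ 2 / (1 + x ^ 2 - 2 * x * t) ^ 2 = k ^ (2 : ℝ) := by
    rw [rpow_two, hk, div_pow]
  rw [mul_div_right_comm, mul_div_right_comm, e₁, ← hk, mul_rpow hkpos.le hxt.le,
    mul_rpow (by positivity) ht2.le, ← rpow_mul hkpos.le]
  have e₂ : k ^ (2 : ℝ) * (k ^ (-β) * k ^ (2 * (β / 2 - 1))) = 1 := by
    rw [← rpow_add hkpos, ← rpow_add hkpos]
    ring_nf
    exact rpow_zero k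
  linear_combination ((x - t) ^ (-β) * (1 - t ^ 2) ^ (β / 2 - 1)) * e₂

theorem integral_sub_rpow_mul_one_sub_sq_rpow_eq {β x : ℝ} (hx : x ∈ Ioo (-1 : ℝ) 1) :
    ∫ t in Ioo (-1) x, (x - t) ^ (-β) * (1 - t ^ 2) ^ (β / 2 - 1) =
      ∫ t in Ioo x 1, (t - x) ^ (-β) * (1 - t ^ 2) ^ (β / 2 - 1) := by
  have hsub : Ioo (-1) x ⊆ Ioo (-1 : ℝ) 1 := Ioo_subset_Ioo_right hx.2.le
  rw [← swapInvolution_image_Ioo hx, integral_image_eq_integral_abs_deriv_smul measurableSet_Ioo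
    (fun t ht => (hasDerivAt_swapInvolution
      (swapInvolution_denom_pos x (hsub ht)).ne').hasDerivWithinAt)
    ((injOn_swapInvolution hx).mono hsub)]
  exact setIntegral_congr_fun measurableSet_Ioo fun t ht =>
    (abs_deriv_mul_comp_swapInvolution hx ht).symm

theorem integrableOn_rpow_sub_mul_one_sub_sq_rpow {r s x : ℝ} (hr : -1 < r) (hs : -1 < s)
    (hx : x ∈ Ioo (-1 : ℝ) 1) :
    IntegrableOn (fun t => (t - x) ^ s * (1 - t ^ 2) ^ r) (Ioo x 1) := by
  have hc : ContinuousOn (fun t : ℝ => (t - -1) ^ r) (uIcc x 1) := by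
    rw [uIcc_of_le hx.2.le]
    exact (by fun_prop : ContinuousOn (fun t : ℝ => t - -1) (Icc x 1)).rpow_const
      fun t ht => Or.inl (sub_pos.2 (hx.1.trans_le ht.1)).ne'
  have h := (intervalIntegrable_sub_rpow_mul_sub_rpow hs hr hx.2).mul_continuousOn hc
  rw [intervalIntegrable_iff_integrableOn_Ioo_of_le hx.2.le] at h
  refine h.congr_fun (fun t ht => ?_) measurableSet_Ioo
  simp only [one_sub_sq_rpow_eq_mul ⟨(hx.1.trans ht.1).le, ht.2.le⟩ r]
  ring

theorem hasDerivAt_integral_one_sub_sq_rpow {r t : ℝ} (hr : -1 < r) (ht : t ∈ Ioo (-1 : ℝ) 1) :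
    HasDerivAt (fun x => ∫ y in (-1 : ℝ)..x, (1 - y ^ 2) ^ r) ((1 - t ^ 2) ^ r) t := by
  have hcont : ContinuousOn (fun y : ℝ => (1 - y ^ 2) ^ r) (Ioo (-1) 1) :=
    (by fun_prop : ContinuousOn (fun y : ℝ => 1 - y ^ 2) (Ioo (-1) 1)).rpow_const
      fun y hy => Or.inl (by nlinarith [hy.1, hy.2] : 0 < 1 - y ^ 2).ne'
  refine intervalIntegral.integral_hasDerivAt_right
    ((intervalIntegrable_one_sub_sq_rpow hr).mono_set ?_)
    (hcont.stronglyMeasurableAtFilter isOpen_Ioo t ht)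
    (hcont.continuousAt (isOpen_Ioo.mem_nhds ht))
  rw [uIcc_of_le ht.1.le, uIcc_of_le (by norm_num)]
  exact Icc_subset_Icc_right ht.2.le

/-- For `β ∈ (0,1)` and
`h(x) = 2^{1−β} (Γ(β)/Γ(β/2)²) ∫_{−1}^x (1−y²)^{β/2−1} dy` on `[−1,1]`: `h(−1) = 0`, `h(1) = 1`,
and for every `x ∈ (−1,1)` all defining integrals converge absolutely and
`(D^β_{−1+*} h)(x) + (D^β_{1−*} h)(x) = 0`. -/
theorem harmonic_function_of_two_sided_caputo
    (β : ℝ) (hβ : β ∈ Set.Ioo (0 : ℝ) 1)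
    (h : ℝ → ℝ)
    (hh : ∀ x : ℝ, h x = (2 : ℝ) ^ (1 - β) * (Real.Gamma β / (Real.Gamma (β / 2)) ^ 2) *
      ∫ y in (-1 : ℝ)..x, (1 - y ^ 2) ^ (β / 2 - 1)) :
    h (-1) = 0 ∧ h 1 = 1 ∧
    ∀ x ∈ Set.Ioo (-1 : ℝ) 1,
      IntegrableOn (fun t => (x - t) ^ (-β) * deriv h t) (Set.Ioc (-1) x) volume ∧
      IntegrableOn (fun t => (t - x) ^ (-β) * deriv h t) (Set.Ico x 1) volume ∧
      caputoL β (-1) h x + caputoR β 1 h x = 0 := by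
  obtain ⟨hβ0, hβ1⟩ := hβ
  set C := (2 : ℝ) ^ (1 - β) * (Real.Gamma β / (Real.Gamma (β / 2)) ^ 2) with hC
  have hr : -1 < β / 2 - 1 := by linarith
  have hs : -1 < -β := by linarith
  have hderiv : ∀ t ∈ Ioo (-1 : ℝ) 1, deriv h t = C * (1 - t ^ 2) ^ (β / 2 - 1) := fun t ht => by
    rw [funext hh]
    exact ((hasDerivAt_integral_one_sub_sq_rpow hr ht).const_mul C).deriv
  refine ⟨by simp [hh], ?_, fun x hx => ?_⟩
  · rw [hh, integral_one_sub_sq_rpow (half_pos hβ0), mul_div_cancel₀ β two_ne_zero, hC]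
    have h₁ := (Real.Gamma_pos_of_pos hβ0).ne'
    have h₂ := (Real.Gamma_pos_of_pos (half_pos hβ0)).ne'
    have h₃ : (2 : ℝ) ^ (1 - β) * 2 ^ (β - 1) = 1 := by
      rw [← rpow_add two_pos]
      simp
    field_simp
    exact h₃
  · have hL : EqOn (fun t => C * ((x - t) ^ (-β) * (1 - t ^ 2) ^ (β / 2 - 1)))
        (fun t => (x - t) ^ (-β) * deriv h t) (Ioo (-1) x) := fun t ht => by
      simp only [hderiv t ⟨ht.1, ht.2.trans hx.2⟩]
      ring
    have hR : EqOn (fun t => C * ((t - x) ^ (-β) * (1 - t ^ 2) ^ (β / 2 - 1)))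
        (fun t => (t - x) ^ (-β) * deriv h t) (Ioo x 1) := fun t ht => by
      simp only [hderiv t ⟨hx.1.trans ht.1, ht.2⟩]
      ring
    refine ⟨?_, ?_, ?_⟩
    · rw [integrableOn_Ioc_iff_integrableOn_Ioo]
      exact IntegrableOn.congr_fun
        ((integrableOn_sub_rpow_mul_one_sub_sq_rpow hr hs hx).const_mul C) hL measurableSet_Ioo
    · rw [integrableOn_Ico_iff_integrableOn_Ioo]
      exact IntegrableOn.congr_fun
        ((integrableOn_rpow_sub_mul_one_sub_sq_rpow hr hs hx).const_mul C) hR measurableSet_Ioo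
    · rw [caputoL, caputoR, integral_Ioc_eq_integral_Ioo, integral_Ico_eq_integral_Ioo,
        ← setIntegral_congr_fun measurableSet_Ioo hL, ← setIntegral_congr_fun measurableSet_Ioo hR,
        integral_const_mul, integral_const_mul, integral_sub_rpow_mul_one_sub_sq_rpow_eq hx,
        add_neg_cancel]
end
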